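/- arXiv:2601.00379 — 5 statements merged into one kernel-verified Lean document; each statement's English description precedes it below -/
import Mathlib

section
/- Let k be an arbitrary field, A an associative k-algebra, and M, N two finite-dimensional A-modules. If dim_k Hom_A(M, X) = dim_k Hom_A(N, X) holds for every A-module X that is a submodule of M or a submodule of N, then M and N are isomorphic as A-modules. Conversely, if M ≅ N then these dimensions agree for all such X. -/
open Module

/-- A retraction `p` of `i : Z → M` splits `M` as the product of `Z` and `ker p`. -/
def LinearMap.prodKerEquivOfRetraction {A Z M : Type*} [Ring A] [AddCommGroup Z] [Module A Z]
    [AddCommGroup M] [Module A M] (i : Z →ₗ[A] M) (p : M →ₗ[A] Z) (h : ∀ z, p (i z) = z) :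
    M ≃ₗ[A] Z × LinearMap.ker p :=
  LinearEquiv.ofLinearMap
    (p.prod ((LinearMap.id - i ∘ₗ p).codRestrict (LinearMap.ker p) fun x => by simp [h]))
    (i.coprod (LinearMap.ker p).subtype)
    (LinearMap.ext fun x => Prod.ext (by simp [h]) (Subtype.ext (by simp [h])))
    (LinearMap.ext fun x => by simp)

section Splitting

variable {A M N : Type*} [Ring A] [AddCommGroup M] [Module A M] [AddCommGroup N] [Module A N]

/-- If a composite `N → M → N` is not nilpotent, then `M` and `N` have a common nonzero
direct summand. -/
theorem LinearMap.exists_common_summand_of_not_isNilpotent [IsNoetherian A N] [IsArtinian A N]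
    (f : N →ₗ[A] M) (g : M →ₗ[A] N) (h : ¬ IsNilpotent (g ∘ₗ f : Module.End A N)) :
    ∃ (Z K : Submodule A N) (C : Submodule A M), Z ≠ ⊥ ∧
      Nonempty (M ≃ₗ[A] Z × C) ∧ Nonempty (N ≃ₗ[A] Z × K) := by
  set e : Module.End A N := g ∘ₗ f
  obtain ⟨n, hn⟩ := Filter.eventually_atTop.mp e.eventually_isCompl_ker_pow_range_pow
  have hc := (hn (n + 1) (Nat.le_succ n)).symm
  set Z := LinearMap.range (e ^ (n + 1))
  set K := LinearMap.ker (e ^ (n + 1))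
  let π := Z.projectionOnto K hc
  let φ : Z →ₗ[A] Z := π ∘ₗ (e ^ (n + 1)) ∘ₗ Z.subtype
  have hφ : Function.Injective φ := by
    rw [← LinearMap.ker_eq_bot, LinearMap.ker_eq_bot']
    intro z hz
    have hmem : (e ^ (n + 1)) z ∈ Z := ⟨z, rfl⟩
    have h0 : (e ^ (n + 1)) (z : N) = 0 := by
      have := (Submodule.projectionOnto_apply_eq_zero_iff hc).mp hz
      exact (Submodule.disjoint_def.mp hc.disjoint) _ hmem this
    exact Subtype.ext (Submodule.disjoint_def.mp hc.disjoint _ z.2 h0)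
  let φe := LinearEquiv.ofBijective φ (IsArtinian.bijective_of_injective_endomorphism φ hφ)
  refine ⟨Z, K, LinearMap.ker (φe.symm.toLinearMap ∘ₗ π ∘ₗ g), ?_,
    ⟨LinearMap.prodKerEquivOfRetraction (f ∘ₗ (e ^ n) ∘ₗ Z.subtype) _ fun z => ?_⟩,
    ⟨(Submodule.prodEquivOfIsCompl Z K hc).symm⟩⟩
  · exact fun hbot => h ⟨n + 1, LinearMap.range_eq_bot.mp hbot⟩
  · have : g (f ((e ^ n) z)) = (e ^ (n + 1)) z := by
      rw [pow_succ']; rfl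
    simp only [LinearMap.comp_apply, Submodule.subtype_apply, LinearEquiv.coe_coe, this]
    exact φe.symm_apply_apply z

/-- If `M` and `N` generate each other and `N ≠ 0`, then some composite `N → M → N` is not
nilpotent. -/
theorem LinearMap.exists_comp_not_isNilpotent [Nontrivial N] [Module.Finite (Module.End A N) N]
    (hM : ⨆ f : N →ₗ[A] M, LinearMap.range f = ⊤) (hN : ⨆ g : M →ₗ[A] N, LinearMap.range g = ⊤) :
    ∃ (f : N →ₗ[A] M) (g : M →ₗ[A] N), ¬ IsNilpotent (g ∘ₗ f : Module.End A N) := by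
  by_contra! hnil
  have hjac (f : N →ₗ[A] M) (g : M →ₗ[A] N) :
      (g ∘ₗ f : Module.End A N) ∈ Ring.jacobson (Module.End A N) := by
    rw [← Ideal.jacobson_bot, Ideal.mem_jacobson_iff]
    intro y
    have hu : IsUnit (1 + y * (g ∘ₗ f : Module.End A N)) := (hnil f (y ∘ₗ g)).isUnit_one_add
    obtain ⟨z, hz⟩ := hu.exists_left_inv
    refine ⟨z, ?_⟩
    rw [Ideal.mem_bot, ← hz]
    noncomm_ring
  have hmap (g : M →ₗ[A] N) (m : M) :
      g m ∈ Ring.jacobson (Module.End A N) • (⊤ : Submodule (Module.End A N) N) := by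
    have hm : m ∈ ⨆ f : N →ₗ[A] M, LinearMap.range f := hM ▸ Submodule.mem_top
    refine Submodule.iSup_induction _ (motive := fun m => g m ∈ _) hm ?_ (by simp)
      fun x y hx hy => by rw [map_add]; exact add_mem hx hy
    rintro f _ ⟨n, rfl⟩
    exact Submodule.smul_mem_smul (hjac f g) (Submodule.mem_top (x := n))
  have htop : (⊤ : Submodule (Module.End A N) N) ≤ Ring.jacobson (Module.End A N) • ⊤ := by
    intro n _
    have hn : n ∈ ⨆ g : M →ₗ[A] N, LinearMap.range g := hN ▸ Submodule.mem_top
    refine Submodule.iSup_induction _ (motive := (· ∈ Ring.jacobson (Module.End A N) • _)) hn ?_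
      (zero_mem _) fun _ _ => add_mem
    rintro g _ ⟨m, rfl⟩
    exact hmap g m
  exact top_ne_bot (Module.Finite.fg_top.eq_bot_of_le_jacobson_smul htop)

end Splitting

section Hom

variable (k : Type*) {A M N X Y : Type*} [Field k] [Ring A] [Algebra k A]
  [AddCommGroup M] [Module A M] [AddCommGroup N] [Module A N]
  [AddCommGroup X] [Module A X] [Module k X] [IsScalarTower k A X]
  [AddCommGroup Y] [Module A Y] [Module k Y] [IsScalarTower k A Y]

theorem LinearEquiv.finrank_hom_eq_left (e : M ≃ₗ[A] N) :
    finrank k (M →ₗ[A] X) = finrank k (N →ₗ[A] X) :=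
  (LinearEquiv.congrLeft X k e).finrank_eq

theorem LinearEquiv.finrank_hom_eq_right (e : X ≃ₗ[A] Y) :
    finrank k (M →ₗ[A] X) = finrank k (M →ₗ[A] Y) :=
  (LinearEquiv.ofLinearMap (LinearMap.compRight k e.toLinearMap)
    (LinearMap.compRight k e.symm.toLinearMap) (by ext; simp) (by ext; simp)).finrank_eq

variable [Module k M] [IsScalarTower k A M]

theorem LinearMap.finiteDimensional_of_tower [Module k N] [IsScalarTower k A N]
    [FiniteDimensional k M] [FiniteDimensional k N] :
    FiniteDimensional k (M →ₗ[A] N) :=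
  FiniteDimensional.of_injective (LinearMap.restrictScalarsₗ k A M N k)
    (LinearMap.restrictScalars_injective k)

theorem LinearMap.finrank_hom_prod [Module k N] [IsScalarTower k A N] [FiniteDimensional k M]
    [FiniteDimensional k N] [FiniteDimensional k X] :
    finrank k (M × N →ₗ[A] X) = finrank k (M →ₗ[A] X) + finrank k (N →ₗ[A] X) := by
  have := LinearMap.finiteDimensional_of_tower k (A := A) (M := M) (N := X)
  have := LinearMap.finiteDimensional_of_tower k (A := A) (M := N) (N := X)
  rw [← (LinearMap.coprodEquiv k (R := A) (M := M) (M₂ := N) (M₃ := X)).finrank_eq,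
    Module.finrank_prod]

/-- A common direct summand can be cancelled from the equality of Hom-dimensions. -/
theorem finrank_hom_eq_of_prod {Z C K : Type*}
    [AddCommGroup Z] [Module A Z] [Module k Z] [IsScalarTower k A Z] [FiniteDimensional k Z]
    [AddCommGroup C] [Module A C] [Module k C] [IsScalarTower k A C] [FiniteDimensional k C]
    [AddCommGroup K] [Module A K] [Module k K] [IsScalarTower k A K] [FiniteDimensional k K]
    [FiniteDimensional k M] (eM : M ≃ₗ[A] Z × C) (eN : N ≃ₗ[A] Z × K)
    (h : ∀ X : Submodule A M, finrank k (M →ₗ[A] X) = finrank k (N →ₗ[A] X)) (X : Submodule A C) :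
    finrank k (C →ₗ[A] X) = finrank k (K →ₗ[A] X) := by
  let ι : C →ₗ[A] M := eM.symm.toLinearMap ∘ₗ LinearMap.inr A Z C
  have hι : Function.Injective ι := eM.symm.injective.comp LinearMap.inr_injective
  have hX := h (X.map ι)
  have e := (Submodule.equivMapOfInjective ι hι X).symm
  have : FiniteDimensional k X :=
    FiniteDimensional.of_injective (X.subtype.restrictScalars k) X.injective_subtype
  rw [e.finrank_hom_eq_right k, e.finrank_hom_eq_right k, eM.finrank_hom_eq_left k,
    eN.finrank_hom_eq_left k, LinearMap.finrank_hom_prod, LinearMap.finrank_hom_prod] at hX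
  exact Nat.add_left_cancel hX

/-- The module `M` is generated by `N` when both have equally large Hom spaces into all
submodules of `M`. -/
theorem iSup_range_eq_top_of_finrank_hom_eq [FiniteDimensional k M]
    (h : ∀ X : Submodule A M, finrank k (M →ₗ[A] X) = finrank k (N →ₗ[A] X)) :
    ⨆ f : N →ₗ[A] M, LinearMap.range f = ⊤ := by
  set T := ⨆ f : N →ₗ[A] M, LinearMap.range f
  have : FiniteDimensional k T :=
    FiniteDimensional.of_injective (T.subtype.restrictScalars k) T.injective_subtype
  have hN : finrank k (N →ₗ[A] T) = finrank k (N →ₗ[A] M) := by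
    refine (LinearEquiv.ofBijective (LinearMap.compRight k T.subtype) ⟨?_, fun f => ?_⟩).finrank_eq
    · exact fun f g hfg => LinearMap.ext fun x => Subtype.ext (LinearMap.congr_fun hfg x)
    · exact ⟨f.codRestrict T fun x =>
        le_iSup (fun f : N →ₗ[A] M => LinearMap.range f) f ⟨x, rfl⟩, rfl⟩
  have hM : finrank k (M →ₗ[A] M) = finrank k (N →ₗ[A] M) := by
    rw [← (Submodule.topEquiv (R := A) (M := M)).finrank_hom_eq_right k, h ⊤,
      (Submodule.topEquiv (R := A) (M := M)).finrank_hom_eq_right k]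
  have := LinearMap.finiteDimensional_of_tower k (A := A) (M := M) (N := M)
  have := LinearMap.finiteDimensional_of_tower k (A := A) (M := M) (N := T)
  have hinj : Function.Injective (LinearMap.compRight k T.subtype : (M →ₗ[A] T) →ₗ[k] M →ₗ[A] M) :=
    fun f g hfg => LinearMap.ext fun x => Subtype.ext (LinearMap.congr_fun hfg x)
  have hsurj := (LinearMap.injective_iff_surjective_of_finrank_eq_finrank
    ((h T).trans (hN.trans hM.symm))).mp hinj
  obtain ⟨r, hr⟩ := hsurj LinearMap.id
  refine Submodule.eq_top_iff'.mpr fun x => ?_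
  have hx : (r x : M) = x := LinearMap.congr_fun hr x
  exact hx ▸ (r x).2

end Hom

/-- Modules with equally large Hom spaces into all submodules of either are isomorphic. -/
theorem nonempty_linearEquiv_of_finrank_hom_eq {k A : Type*} [Field k] [Ring A] [Algebra k A]
    {M : Type*} {N : Type*}
    [AddCommGroup M] [Module A M] [Module k M] [IsScalarTower k A M]
    [AddCommGroup N] [Module A N] [Module k N] [IsScalarTower k A N]
    [FiniteDimensional k M] [FiniteDimensional k N]
    (hM : ∀ X : Submodule A M, finrank k (M →ₗ[A] X) = finrank k (N →ₗ[A] X))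
    (hN : ∀ X : Submodule A N, finrank k (M →ₗ[A] X) = finrank k (N →ₗ[A] X)) :
    Nonempty (M ≃ₗ[A] N) := by
  induction hd : finrank k N using Nat.strong_induction_on generalizing M N with
  | _ d ih =>
    have tM := iSup_range_eq_top_of_finrank_hom_eq k hM
    have tN := iSup_range_eq_top_of_finrank_hom_eq k fun X => (hN X).symm
    rcases subsingleton_or_nontrivial N with _ | _
    · have : Subsingleton M := by
        rw [← Submodule.subsingleton_iff A, ← subsingleton_iff_bot_eq_top, ← tM]
        refine (iSup_eq_bot.mpr fun f => ?_).symm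
        rw [LinearMap.range_eq_bot]
        exact LinearMap.ext fun x => by simp [Subsingleton.elim x 0]
      exact ⟨0⟩
    · have : IsNoetherian A N := isNoetherian_of_tower k inferInstance
      have : IsArtinian A N := isArtinian_of_tower k inferInstance
      have : Module.Finite (Module.End A N) N := Module.Finite.of_restrictScalars_finite k _ _
      obtain ⟨f, g, hfg⟩ := LinearMap.exists_comp_not_isNilpotent tM tN
      obtain ⟨Z, K, C, hZ, ⟨eM⟩, ⟨eN⟩⟩ :=
        LinearMap.exists_common_summand_of_not_isNilpotent f g hfg
      have finN (X : Submodule A N) : FiniteDimensional k X :=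
        FiniteDimensional.of_injective (X.subtype.restrictScalars k) X.injective_subtype
      have : FiniteDimensional k C :=
        FiniteDimensional.of_injective (C.subtype.restrictScalars k) C.injective_subtype
      have hlt : finrank k K < d := by
        have := Submodule.nontrivial_iff_ne_bot.mpr hZ
        have hpos : 0 < finrank k Z := finrank_pos
        have := (eN.restrictScalars k).finrank_eq
        rw [Module.finrank_prod] at this
        omega
      obtain ⟨e⟩ := ih _ hlt (finrank_hom_eq_of_prod k eM eN hM)
        (fun X => (finrank_hom_eq_of_prod k eN eM (fun X => (hN X).symm) X).symm) rfl
      exact ⟨eM.trans (((LinearEquiv.refl A Z).prodCongr e).trans eN.symm)⟩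


/-- Two finite-dimensional modules `M`, `N` over a `k`-algebra `A`
are isomorphic iff `dim_k Hom_A(M, X) = dim_k Hom_A(N, X)` for every submodule `X`
of `M` or of `N`. -/
theorem stmt0 {k A : Type*} [Field k] [Ring A] [Algebra k A]
    {M N : Type*}
    [AddCommGroup M] [Module A M] [Module k M] [IsScalarTower k A M]
    [AddCommGroup N] [Module A N] [Module k N] [IsScalarTower k A N]
    [FiniteDimensional k M] [FiniteDimensional k N] :
    Nonempty (M ≃ₗ[A] N) ↔
      ((∀ X : Submodule A M,
          Module.finrank k (M →ₗ[A] X) = Module.finrank k (N →ₗ[A] X)) ∧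
       (∀ X : Submodule A N,
          Module.finrank k (M →ₗ[A] X) = Module.finrank k (N →ₗ[A] X))) := by
  refine ⟨fun ⟨e⟩ => ⟨fun X => e.finrank_hom_eq_left k, fun X => e.finrank_hom_eq_left k⟩,
    fun ⟨hM, hN⟩ => nonempty_linearEquiv_of_finrank_hom_eq hM hN⟩
end

section
/- Let k be an arbitrary field, A an associative k-algebra, and M, N two finite-dimensional A-modules. If dim_k Hom_A(X, M) = dim_k Hom_A(X, N) holds for every A-module X that is a submodule of M or a submodule of N, then M and N are isomorphic as A-modules. Conversely, if M ≅ N then these dimensions agree for all such X. -/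
namespace Matrix

theorem exists_linearIndependent_rows {E : Type*} [Field E] {p q : Type*} [Fintype p] [Fintype q]
    (B : Matrix p q E) {r : ℕ} (hr : B.rank = r) :
    ∃ s : Fin r → p, LinearIndependent E (B.submatrix s id).row := by
  subst hr
  rw [rank_eq_finrank_span_row]
  obtain ⟨f, hf, -, hli⟩ := Submodule.exists_fun_fin_finrank_span_eq E (Set.range B.row)
  choose s hs using hf
  have hs' : (B.submatrix s id).row = f := funext hs
  exact ⟨s, hs' ▸ hli⟩

theorem exists_submatrix_det_ne_zero {E : Type*} [Field E] {p q : Type*} [Fintype p] [Fintype q]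
    (B : Matrix p q E) {r : ℕ} (hr : B.rank = r) :
    ∃ (s : Fin r → p) (t : Fin r → q), (B.submatrix s t).det ≠ 0 := by
  obtain ⟨s, hs⟩ := B.exists_linearIndependent_rows hr
  have h1 : (B.submatrix s id)ᵀ.rank = r := by
    rw [rank_transpose, hs.rank_matrix, Fintype.card_fin]
  obtain ⟨t, ht⟩ := exists_linearIndependent_rows _ h1
  refine ⟨s, t, ?_⟩
  have h2 := linearIndependent_rows_iff_isUnit.1 ht
  rw [isUnit_iff_isUnit_det, isUnit_iff_ne_zero] at h2
  rwa [← det_transpose]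

theorem le_rank_of_det_ne_zero {E : Type*} [Field E] {p q : Type*} [Fintype p] [Fintype q]
    (B : Matrix p q E) {r : ℕ} (s : Fin r → p) (t : Fin r → q)
    (h : (B.submatrix s t).det ≠ 0) : r ≤ B.rank := by
  have := rank_of_det_ne_zero h
  rw [Fintype.card_fin] at this
  exact this.symm.le.trans (rank_submatrix_le _ _ _)

theorem rank_map_le_rank_map {R E E' : Type*} [CommRing R] [Field E] [Field E']
    {p q : Type*} [Fintype p] [Fintype q] (B : Matrix p q R)
    (φ : R →+* E) (hφ : Function.Injective φ) (ψ : R →+* E') :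
    (B.map ψ).rank ≤ (B.map φ).rank := by
  obtain ⟨s, t, h⟩ := (B.map ψ).exists_submatrix_det_ne_zero rfl
  refine le_rank_of_det_ne_zero _ s t fun h0 ↦ h ?_
  rw [submatrix_map, ← RingHom.mapMatrix_apply, ← RingHom.map_det] at h0 ⊢
  rw [(map_eq_zero_iff φ hφ).1 h0, map_zero]

theorem exists_ne_zero_rank_map_eq {R E E' : Type*} [CommRing R] [Field E] [Field E']
    {p q : Type*} [Fintype p] [Fintype q] (B : Matrix p q R)
    (φ : R →+* E) (hφ : Function.Injective φ) :
    ∃ d : R, d ≠ 0 ∧ ∀ ψ : R →+* E', ψ d ≠ 0 → (B.map ψ).rank = (B.map φ).rank := by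
  obtain ⟨s, t, h⟩ := (B.map φ).exists_submatrix_det_ne_zero rfl
  rw [submatrix_map, ← RingHom.mapMatrix_apply, ← RingHom.map_det] at h
  refine ⟨(B.submatrix s t).det, fun h0 ↦ h (by rw [h0, map_zero]), fun ψ hψ ↦
    (rank_map_le_rank_map B φ hφ ψ).antisymm (le_rank_of_det_ne_zero _ s t ?_)⟩
  rwa [submatrix_map, ← RingHom.mapMatrix_apply, ← RingHom.map_det]

theorem exists_eq_mul_iff_ker_le {E : Type*} [Field E] {a b m : Type*} [Fintype a] [Fintype b]
    [Fintype m] (F : Matrix a m E) (G : Matrix b m E) :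
    (∃ U : Matrix b a E, G = U * F) ↔
      LinearMap.ker F.mulVecLin ≤ LinearMap.ker G.mulVecLin := by
  classical
  constructor
  · rintro ⟨U, rfl⟩
    rw [mulVecLin_mul]
    exact LinearMap.ker_le_ker_comp _ _
  · intro h
    obtain ⟨u, hu⟩ := LinearMap.exists_extend
      ((LinearMap.ker F.mulVecLin).liftQ G.mulVecLin h ∘ₗ
        F.mulVecLin.quotKerEquivRange.symm.toLinearMap)
    refine ⟨LinearMap.toMatrix' u, ?_⟩
    apply Matrix.toLin'.injective
    rw [toLin'_mul, toLin'_toMatrix']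
    ext1 i
    ext1
    have := LinearMap.congr_fun hu (F.mulVecLin.rangeRestrict (Pi.single i 1))
    simp only [LinearMap.comp_apply, LinearEquiv.coe_coe] at this
    have h2 : F.mulVecLin.quotKerEquivRange.symm (F.mulVecLin.rangeRestrict (Pi.single i 1)) =
        (LinearMap.ker F.mulVecLin).mkQ (Pi.single i 1) := by
      rw [LinearEquiv.symm_apply_eq]; rfl
    rw [h2] at this
    simpa using this.symm

theorem exists_eq_mul_of_rank_eq {E : Type*} [Field E] {a b m : Type*} [Fintype a] [Fintype b]
    [Fintype m] {F : Matrix a m E} {G : Matrix b m E} {U : Matrix b a E} (h : G = U * F)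
    (hr : G.rank = F.rank) : ∃ V : Matrix a b E, F = V * G := by
  rw [exists_eq_mul_iff_ker_le]
  have h1 := (exists_eq_mul_iff_ker_le F G).1 ⟨U, h⟩
  refine (Submodule.eq_of_le_of_finrank_eq h1 ?_).ge
  have h2 := F.mulVecLin.finrank_range_add_finrank_ker
  have h3 := G.mulVecLin.finrank_range_add_finrank_ker
  simp only [rank] at hr
  lia

end Matrix

theorem exists_sum_smul_eq_of_mem {E V : Type*} [Field E] [AddCommGroup V] [Module E V]
    {e : ℕ} {S : Submodule E V} [FiniteDimensional E S] (hS : Module.finrank E S = e)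
    {w : Fin e → V}
    (hw : ∀ i, w i ∈ S) (hli : LinearIndependent E w) {v : V} (hv : v ∈ S) :
    ∃ z : Fin e → E, ∑ i, z i • w i = v := by
  have hle : Submodule.span E (Set.range w) ≤ S :=
    Submodule.span_le.2 (by rintro _ ⟨i, rfl⟩; exact hw i)
  have := Submodule.eq_of_le_of_finrank_eq hle (by
    rw [finrank_span_eq_card hli, hS, Fintype.card_fin])
  rwa [← this, Submodule.mem_span_range_iff_exists_fun] at hv

namespace Matrix

variable {E E' R k : Type*} [CommRing k]

/-- The linear combination of the matrices `g i` with coefficients `c i` in a `k`-algebra. -/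
def comb [CommRing E] [Algebra k E] {n : ℕ} {b m : Type*} (g : Fin n → Matrix b m k)
    (c : Fin n → E) : Matrix b m E :=
  ∑ i, c i • (g i).map (algebraMap k E)

theorem comb_apply [CommRing E] [Algebra k E] {n : ℕ} {b m : Type*} (g : Fin n → Matrix b m k)
    (c : Fin n → E) (p : b) (q : m) : comb g c p q = ∑ i, c i * algebraMap k E (g i p q) := by
  simp [comb, Matrix.sum_apply]

theorem comb_map [CommRing E] [Algebra k E] [CommRing E'] [Algebra k E'] {n : ℕ} {b m : Type*}
    (g : Fin n → Matrix b m k) (c : Fin n → E) (φ : E →ₐ[k] E') :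
    (comb g c).map φ = comb g (φ ∘ c) := by
  ext p q
  simp [comb_apply]

theorem comb_add [CommRing E] [Algebra k E] {n : ℕ} {b m : Type*} (g : Fin n → Matrix b m k)
    (c d : Fin n → E) : comb g (c + d) = comb g c + comb g d := by
  simp [comb, add_smul, Finset.sum_add_distrib]

theorem comb_smul [CommRing E] [Algebra k E] {n : ℕ} {b m : Type*} (g : Fin n → Matrix b m k)
    (t : E) (c : Fin n → E) : comb g (t • c) = t • comb g c := by
  simp [comb, smul_smul, Finset.smul_sum]

/-- The coefficient vectors `c` for which the combination `comb g c` factors through `F`. -/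
def fac [CommRing E] [Algebra k E] {n : ℕ} {a b m : Type*} [Fintype a] (g : Fin n → Matrix b m k)
    (F : Matrix a m E) : Submodule E (Fin n → E) where
  carrier := {c | ∃ U : Matrix b a E, comb g c = U * F}
  add_mem' := by
    rintro c d ⟨U, hU⟩ ⟨V, hV⟩
    exact ⟨U + V, by rw [comb_add, hU, hV, Matrix.add_mul]⟩
  zero_mem' := ⟨0, by simp [comb]⟩
  smul_mem' := by
    rintro t c ⟨U, hU⟩
    exact ⟨t • U, by rw [comb_smul, hU, Matrix.smul_mul]⟩

theorem mem_fac [CommRing E] [Algebra k E] {n : ℕ} {a b m : Type*} [Fintype a]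
    {g : Fin n → Matrix b m k} {F : Matrix a m E} {c : Fin n → E} :
    c ∈ fac g F ↔ ∃ U : Matrix b a E, comb g c = U * F := Iff.rfl

/-- The matrix of the linear map `(c, U) ↦ comb g c - U * F`. -/
def facMatrix [CommRing E] [Algebra k E] {n : ℕ} {a b m : Type*} [DecidableEq b]
    (g : Fin n → Matrix b m k) (F : Matrix a m E) : Matrix (b × m) (Fin n ⊕ b × a) E :=
  of fun p ↦ Sum.elim (fun i ↦ algebraMap k E (g i p.1 p.2))
    (fun j ↦ if p.1 = j.1 then -F j.2 p.2 else 0)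

theorem facMatrix_map [CommRing E] [Algebra k E] [CommRing E'] [Algebra k E'] {n : ℕ}
    {a b m : Type*} [DecidableEq b]
    (g : Fin n → Matrix b m k) (F : Matrix a m E) (φ : E →ₐ[k] E') :
    (facMatrix g F).map φ = facMatrix g (F.map φ) := by
  ext p (i | j)
  · simp [facMatrix]
  · simp only [facMatrix, map_apply, of_apply, Sum.elim_inr]
    split_ifs <;> simp

theorem mem_ker_facMatrix [CommRing E] [Algebra k E] {n : ℕ} {a b m : Type*} [DecidableEq b]
    [Fintype a] [Fintype b]
    (g : Fin n → Matrix b m k) (F : Matrix a m E) (v : Fin n ⊕ b × a → E) :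
    v ∈ LinearMap.ker (facMatrix g F).mulVecLin ↔
      comb g (v ∘ Sum.inl) = of (fun p s ↦ v (Sum.inr (p, s))) * F := by
  rw [LinearMap.mem_ker, ← sub_eq_zero, ← Matrix.ext_iff, funext_iff, Prod.forall]
  refine forall₂_congr fun p q ↦ ?_
  simp [facMatrix, mulVec, dotProduct, Fintype.sum_sum_type, Fintype.sum_prod_type, comb_apply,
    mul_apply, mul_comm, Finset.sum_ite_irrel, ← sub_eq_add_neg, sub_eq_zero]

theorem finrank_fac_add [Field E] [Algebra k E] {n : ℕ} {a b m : Type*} [DecidableEq b]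
    [Fintype a] [Fintype b] [Fintype m] (g : Fin n → Matrix b m k) (F : Matrix a m E) :
    Module.finrank E (fac g F) + (facMatrix g F).rank =
      n + (facMatrix (Fin.elim0 : Fin 0 → Matrix b m k) F).rank := by
  let K := LinearMap.ker (facMatrix g F).mulVecLin
  let K₀ := LinearMap.ker (facMatrix (Fin.elim0 : Fin 0 → Matrix b m k) F).mulVecLin
  let π : K →ₗ[E] (Fin n → E) := LinearMap.funLeft E E Sum.inl ∘ₗ K.subtype
  have h1 : LinearMap.range π = fac g F := by
    ext c
    constructor
    · rintro ⟨v, rfl⟩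
      exact ⟨_, (mem_ker_facMatrix g F v).1 v.2⟩
    · rintro ⟨U, hU⟩
      exact ⟨⟨Sum.elim c (fun p ↦ U p.1 p.2), (mem_ker_facMatrix g F _).2 hU⟩, rfl⟩
  let j : K₀ →ₗ[E] K := LinearMap.codRestrict K
    ({ toFun := fun v ↦ Sum.elim 0 (v ∘ Sum.inr)
       map_add' := fun v w ↦ by ext (i | i) <;> simp
       map_smul' := fun t w ↦ by ext (i | i) <;> simp } ∘ₗ K₀.subtype) fun v ↦ by
      have := (mem_ker_facMatrix _ F _).1 v.2
      refine (mem_ker_facMatrix g F _).2 (Eq.trans ?_ this)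
      simp [comb]
  have hj : Function.Injective j := by
    intro v w h
    ext (i | i)
    · exact i.elim0
    · exact congrFun (congrArg Subtype.val h) (Sum.inr i)
  have h2 : LinearMap.range j = LinearMap.ker π := by
    ext v
    constructor
    · rintro ⟨w, rfl⟩
      rw [LinearMap.mem_ker]
      rfl
    · intro hv
      have hv' : (v : Fin n ⊕ b × a → E) ∘ Sum.inl = 0 := hv
      refine ⟨⟨Sum.elim Fin.elim0 ((v : Fin n ⊕ b × a → E) ∘ Sum.inr), ?_⟩, ?_⟩
      · refine (mem_ker_facMatrix _ F _).2 (Eq.trans ?_ ((mem_ker_facMatrix g F _).1 v.2))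
        rw [hv']
        simp [comb]
      · ext (i | i)
        · exact (congrFun hv' i).symm
        · rfl
  have e1 := π.finrank_range_add_finrank_ker
  rw [h1, ← h2, LinearMap.finrank_range_of_inj hj] at e1
  have e2 := (facMatrix g F).mulVecLin.finrank_range_add_finrank_ker
  have e3 := (facMatrix (Fin.elim0 : Fin 0 → Matrix b m k) F)
    |>.mulVecLin.finrank_range_add_finrank_ker
  simp only [Module.finrank_fintype_fun_eq_card, Fintype.card_sum, Fintype.card_prod,
    Fintype.card_fin] at e2 e3
  simp only [rank]
  change _ + Module.finrank E K = _ at e2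
  change _ + Module.finrank E K₀ = _ at e3
  lia

theorem finrank_fac_map_eq [CommRing R] [Algebra k R] [Field E] [Algebra k E] [Field E']
    [Algebra k E'] {n : ℕ} {a b m : Type*} [Fintype a] [Fintype b] [Fintype m]
    (g : Fin n → Matrix b m k) (F : Matrix a m R) (φ : R →ₐ[k] E) (hφ : Function.Injective φ)
    (ψ : R →ₐ[k] E') (hψ : Function.Injective ψ) :
    Module.finrank E (fac g (F.map φ)) = Module.finrank E' (fac g (F.map ψ)) := by
  classical
  have key {n' : ℕ} (g' : Fin n' → Matrix b m k) :
      (facMatrix g' (F.map φ)).rank = (facMatrix g' (F.map ψ)).rank := by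
    rw [← facMatrix_map, ← facMatrix_map]
    exact le_antisymm (rank_map_le_rank_map _ ψ.toRingHom hψ φ.toRingHom)
      (rank_map_le_rank_map _ φ.toRingHom hφ ψ.toRingHom)
  have h1 := finrank_fac_add g (F.map φ)
  have h2 := finrank_fac_add g (F.map ψ)
  rw [key, key] at h1
  lia

theorem exists_ne_zero_finrank_fac_map_eq [CommRing R] [IsDomain R] [Algebra k R] [Field E]
    [Algebra k E] [Field E']
    [Algebra k E'] {n : ℕ} {a b m : Type*} [Fintype a] [Fintype b] [Fintype m]
    (g : Fin n → Matrix b m k) (F : Matrix a m R) (φ : R →ₐ[k] E) (hφ : Function.Injective φ) :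
    ∃ d : R, d ≠ 0 ∧ ∀ ψ : R →ₐ[k] E', ψ d ≠ 0 →
      Module.finrank E' (fac g (F.map ψ)) = Module.finrank E (fac g (F.map φ)) := by
  classical
  obtain ⟨d₁, hd₁, h₁⟩ := exists_ne_zero_rank_map_eq (E' := E') (facMatrix g F) φ.toRingHom hφ
  obtain ⟨d₂, hd₂, h₂⟩ := exists_ne_zero_rank_map_eq (E' := E')
    (facMatrix (Fin.elim0 : Fin 0 → Matrix b m k) F) φ.toRingHom hφ
  refine ⟨d₁ * d₂, mul_ne_zero hd₁ hd₂, fun ψ hψ ↦ ?_⟩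
  rw [map_mul, mul_ne_zero_iff] at hψ
  have e₁ : ((facMatrix g F).map ψ).rank = ((facMatrix g F).map φ).rank := h₁ ψ.toRingHom hψ.1
  have e₂ : ((facMatrix (Fin.elim0 : Fin 0 → Matrix b m k) F).map ψ).rank =
    ((facMatrix (Fin.elim0 : Fin 0 → Matrix b m k) F).map φ).rank := h₂ ψ.toRingHom hψ.2
  simp only [facMatrix_map] at e₁ e₂
  have h1 := finrank_fac_add g (F.map φ)
  have h2 := finrank_fac_add g (F.map ψ)
  rw [e₁, e₂] at h2
  lia

end Matrix

theorem algebraicIndependent_of_forall_mem_adjoin {k Ω ι κ : Type*} [Field k] [Field Ω]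
    [Algebra k Ω] [Finite κ] {x : ι → Ω} (hx : IsTranscendenceBasis k x) {v : κ → Ω}
    (hcard : Nat.card κ = Nat.card ι) [Finite ι]
    (h : ∀ i, x i ∈ IntermediateField.adjoin k (Set.range v)) : AlgebraicIndependent k v := by
  have halg : Algebra.IsAlgebraic (Algebra.adjoin k (Set.range v)) Ω := by
    rw [hx.isAlgebraic_iff]
    intro i
    obtain ⟨r, hr, s, hs, hrs⟩ := IntermediateField.mem_adjoin_iff_div.1 (h i)
    rw [hrs, div_eq_mul_inv]
    exact (isAlgebraic_algebraMap (⟨r, hr⟩ : Algebra.adjoin k (Set.range v))).mul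
      (isAlgebraic_algebraMap (⟨s, hs⟩ : Algebra.adjoin k (Set.range v))).inv
  refine (Algebra.IsAlgebraic.isTranscendenceBasis_of_lift_le_trdeg_of_finite k v ?_).1
  have e1 := hx.lift_cardinalMk_eq_trdeg
  rw [← Nat.cast_card, Cardinal.lift_natCast] at e1
  have e2 : Algebra.trdeg k Ω = (Nat.card ι : Cardinal) :=
    Cardinal.lift_injective (e1.symm.trans (Cardinal.lift_natCast _).symm)
  rw [← Nat.cast_card, e2, hcard, Cardinal.lift_natCast, Cardinal.lift_natCast]

theorem MvPolynomial.exists_aeval_ne_zero {k σ : Type*} [Field k] [Infinite k]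
    {p : MvPolynomial σ k} (hp : p ≠ 0) : ∃ u : σ → k, aeval u p ≠ 0 := by
  by_contra! h
  exact hp (MvPolynomial.funext fun u ↦ by simpa [aeval_eq_eval] using h u)

namespace Matrix

theorem exists_linearIndependent_fac {k R E : Type*} [CommRing k] [CommRing R] [IsDomain R]
    [Algebra k R] [Field E] [Algebra k E] [Algebra R E] [IsScalarTower k R E] [IsFractionRing R E]
    {n : ℕ} {a b m : Type*} [Fintype a] [Finite b]
    (g : Fin n → Matrix b m k) (F : Matrix a m R) {e : ℕ}
    (he : Module.finrank E (fac g (F.map (algebraMap R E))) = e) :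
    ∃ (β : Fin e → Fin n → R) (U : Fin e → Matrix b a R),
      (∀ i, comb g (β i) = U i * F) ∧
      LinearIndependent E (fun i ↦ algebraMap R E ∘ β i) := by
  let B := Module.finBasisOfFinrankEq E _ he
  choose U hU using fun i ↦ (B i).2
  obtain ⟨⟨d, hd⟩, h⟩ := IsLocalization.exist_integer_multiples_of_finite (nonZeroDivisors R)
    (Sum.elim (fun p : Fin e × Fin n ↦ (B p.1 : Fin n → E) p.2)
      (fun p : Fin e × b × a ↦ U p.1 p.2.1 p.2.2))
  have h1 : ∀ (i : Fin e) (j : Fin n), ∃ r, algebraMap R E r = d • (B i : Fin n → E) j :=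
    fun i j ↦ h (Sum.inl (i, j))
  have h2 : ∀ (i : Fin e) (p : b) (q : a), ∃ r, algebraMap R E r = d • U i p q :=
    fun i p q ↦ h (Sum.inr (i, p, q))
  choose β hβ using h1
  choose V hV using h2
  have hβ' (i) : algebraMap R E ∘ β i = algebraMap R E d • (B i : Fin n → E) := by
    ext j
    simp [hβ, Algebra.smul_def]
  refine ⟨β, fun i ↦ of (V i), fun i ↦ ?_, ?_⟩
  · have hinj : Function.Injective (fun M : Matrix b m R ↦ M.map (algebraMap R E)) :=
      Matrix.map_injective (IsFractionRing.injective R E)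
    apply hinj
    have hV' : (of (V i)).map (algebraMap R E) = algebraMap R E d • U i := by
      ext p q
      simp [hV, Algebra.smul_def]
    change (comb g (β i)).map (IsScalarTower.toAlgHom k R E) = _
    rw [comb_map]
    change comb g (algebraMap R E ∘ β i) = (of (V i) * F).map (algebraMap R E)
    rw [Matrix.map_mul, hβ', comb_smul, hU, hV', Matrix.smul_mul]
  · have hd' : algebraMap R E d ≠ 0 :=
      IsLocalization.to_map_ne_zero_of_mem_nonZeroDivisors E le_rfl hd
    have := (B.linearIndependent.map' _ (Submodule.ker_subtype _)).units_smul
      (fun _ ↦ Units.mk0 _ hd')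
    have heq : (fun i ↦ algebraMap R E ∘ β i) =
        fun i ↦ algebraMap R E d • (B i : Fin n → E) := funext hβ'
    rw [heq]
    exact this

theorem exists_submatrix_det_ne_zero_of_linearIndependent {R E : Type*} [CommRing R] [Field E]
    (φ : R →+* E) {e n : ℕ} (β : Matrix (Fin e) (Fin n) R)
    (h : LinearIndependent E (β.map φ).row) :
    ∃ s : Fin e → Fin n, (β.submatrix id s).det ≠ 0 := by
  have h1 : (β.map φ)ᵀ.rank = e := by rw [rank_transpose, h.rank_matrix, Fintype.card_fin]
  obtain ⟨s, hs⟩ := exists_linearIndependent_rows _ h1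
  refine ⟨s, fun h0 ↦ ?_⟩
  rw [linearIndependent_rows_iff_isUnit, isUnit_iff_isUnit_det, isUnit_iff_ne_zero,
    ← det_transpose] at hs
  apply hs
  change (φ.mapMatrix (β.submatrix id s)).det = 0
  rw [← RingHom.map_det, h0, map_zero]

theorem linearIndependent_row_of_submatrix_det_ne_zero {E : Type*} [Field E]
    {e n : ℕ} (β : Matrix (Fin e) (Fin n) E) (s : Fin e → Fin n)
    (h : (β.submatrix id s).det ≠ 0) : LinearIndependent E β.row := by
  have := (linearIndependent_rows_iff_isUnit (A := β.submatrix id s)).2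
    ((isUnit_iff_isUnit_det _).2 (isUnit_iff_ne_zero.2 h))
  exact LinearIndependent.of_comp (LinearMap.funLeft E E s) this

theorem fac_eq_of_rank_eq {k E : Type*} [CommRing k] [Field E] [Algebra k E]
    {n : ℕ} {a b b' m : Type*} [Fintype a] [Fintype b] [Fintype m]
    (f : Fin n → Matrix b' m k) {F : Matrix a m E} {G : Matrix b m E} {U : Matrix b a E}
    (h : G = U * F) (hr : G.rank = F.rank) : fac f G = fac f F := by
  obtain ⟨V, hV⟩ := exists_eq_mul_of_rank_eq h hr
  ext c
  constructor
  · rintro ⟨W, hW⟩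
    exact ⟨W * U, by rw [hW, h, Matrix.mul_assoc]⟩
  · rintro ⟨W, hW⟩
    exact ⟨W * V, by rw [hW, Matrix.mul_assoc, ← hV]⟩

theorem mem_of_vecMul_mem {k Ω : Type*} [Field k] [Field Ω] [Algebra k Ω]
    (T : IntermediateField k Ω) {e : ℕ} (M : Matrix (Fin e) (Fin e) Ω) (hM : ∀ i j, M i j ∈ T)
    (hdet : M.det ≠ 0) (y : Fin e → Ω) (hy : ∀ j, (y ᵥ* M) j ∈ T) (i : Fin e) : y i ∈ T := by
  have hM' : M = (of fun i j ↦ (⟨M i j, hM i j⟩ : T)).map T.val := rfl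
  have hinv : ∀ i j, M⁻¹ i j ∈ T := fun i j ↦ by
    rw [inv_def, Ring.inverse_eq_inv', smul_apply, smul_eq_mul]
    refine mul_mem (inv_mem ?_) ?_
    · rw [hM']
      change (T.val.toRingHom.mapMatrix _).det ∈ T
      rw [← RingHom.map_det]
      exact Subtype.property _
    · rw [hM']
      change (T.val.toRingHom.mapMatrix _).adjugate i j ∈ T
      rw [← RingHom.map_adjugate]
      exact Subtype.property _
  have h : y = (y ᵥ* M) ᵥ* M⁻¹ := by
    rw [vecMul_vecMul, mul_nonsing_inv _ (isUnit_iff_ne_zero.2 hdet), vecMul_one]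
  rw [h, vecMul, dotProduct]
  exact sum_mem fun j _ ↦ mul_mem (hy j) (hinv j i)

theorem comb_sum_smul {k E : Type*} [CommRing k] [CommRing E] [Algebra k E] {n : ℕ}
    {b m ι : Type*} (g : Fin n → Matrix b m k) (s : Finset ι) (y : ι → E) (β : ι → Fin n → E) :
    comb g (∑ j ∈ s, y j • β j) = ∑ j ∈ s, y j • comb g (β j) := by
  ext p q
  simp only [comb_apply, Finset.sum_apply, Pi.smul_apply, smul_eq_mul, Matrix.sum_apply,
    Matrix.smul_apply, Finset.mul_sum, Finset.sum_mul, mul_assoc]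
  exact Finset.sum_comm

theorem aeval_X_map_comb {k E : Type*} [CommRing k] [CommRing E] [Algebra k E] {n : ℕ}
    {b m : Type*} (g : Fin n → Matrix b m k) (x : Fin n → E) :
    (comb g MvPolynomial.X).map (MvPolynomial.aeval (R := k) x) = comb g x := by
  rw [comb_map]
  congr 1
  ext i
  exact MvPolynomial.aeval_X _ _

theorem comb_sum_smul_eq_mul {k R E : Type*} [CommRing k] [CommRing R] [Algebra k R]
    [CommRing E] [Algebra k E] (φ : R →ₐ[k] E) {n e : ℕ} {a b m : Type*} [Fintype a]
    (g : Fin n → Matrix b m k) {F : Matrix a m R} {β : Fin e → Fin n → R}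
    {U : Fin e → Matrix b a R} (hU : ∀ i, comb g (β i) = U i * F) (y : Fin e → E) :
    comb g (∑ j, y j • (φ ∘ β j)) = (∑ j, y j • (U j).map φ) * F.map φ := by
  rw [comb_sum_smul, Matrix.sum_mul]
  refine Finset.sum_congr rfl fun j _ ↦ ?_
  rw [Matrix.smul_mul, ← comb_map, hU]
  congr 1
  exact Matrix.map_mul (f := φ.toRingHom)

theorem comb_rename_map_aeval {k E : Type*} [CommRing k] [CommRing E] [Algebra k E] {n e : ℕ}
    {b m : Type*} (g : Fin n → Matrix b m k) (β : Fin e → Fin n → MvPolynomial (Fin n) k)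
    (x : Fin n → E) (y : Fin e → E) :
    (comb g (∑ j, (MvPolynomial.X (Sum.inr j) : MvPolynomial (Fin n ⊕ Fin e) k) •
      (MvPolynomial.rename Sum.inl ∘ β j))).map (MvPolynomial.aeval (R := k) (Sum.elim x y)) =
      comb g (∑ j, y j • (MvPolynomial.aeval x ∘ β j)) := by
  rw [comb_map]
  congr 1
  ext i
  simp only [Function.comp_apply, Finset.sum_apply, Pi.smul_apply, smul_eq_mul, map_sum,
    map_mul, MvPolynomial.aeval_rename, MvPolynomial.aeval_X, Sum.elim_inr]
  rfl

/-- The rank of a combination at an algebraically independent point is at least its rank at any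
other point. -/
theorem rank_comb_sum_smul_le {k Ω E : Type*} [Field k] [Field Ω] [Algebra k Ω] [Field E]
    [Algebra k E] {n e : ℕ} {b m : Type*} [Fintype b] [Fintype m] (g : Fin n → Matrix b m k)
    (β : Fin e → Fin n → MvPolynomial (Fin n) k) {x : Fin n → Ω} {y : Fin e → Ω}
    (hxy : AlgebraicIndependent k (Sum.elim x y)) (u : Fin n → E) (v : Fin e → E) :
    (comb g (∑ j, v j • (MvPolynomial.aeval u ∘ β j))).rank ≤
      (comb g (∑ j, y j • (MvPolynomial.aeval x ∘ β j))).rank := by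
  rw [← comb_rename_map_aeval, ← comb_rename_map_aeval]
  exact rank_map_le_rank_map _ (MvPolynomial.aeval (R := k) (Sum.elim x y)).toRingHom hxy
    (MvPolynomial.aeval (R := k) (Sum.elim u v)).toRingHom

/-- A generic combination `comb g c`, from whose row space the generic point `x` can be recovered
with as few parameters as were used to define `c`, has algebraically independent coefficients. -/
theorem algebraicIndependent_of_mem_fac {k Ω : Type*} [Field k] [Field Ω] [Algebra k Ω]
    {n e : ℕ} {b m b' : Type*} [Fintype b] [Fintype m] [Fintype b']
    (f : Fin n → Matrix b' m k) (g : Fin n → Matrix b m k)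
    (β : Fin e → Fin n → MvPolynomial (Fin n) k) (s : Fin e → Fin n)
    (hs : ((of β).submatrix id s).det ≠ 0) {x : Fin n → Ω} {y : Fin e → Ω}
    (hxy : IsTranscendenceBasis k (Sum.elim x y)) {c : Fin n → Ω}
    (hc : c = ∑ j, y j • (MvPolynomial.aeval x ∘ β j))
    (he : Module.finrank Ω (fac f (comb g c)) = e) (hx : x ∈ fac f (comb g c)) :
    AlgebraicIndependent k c := by
  let L := IntermediateField.adjoin k (Set.range c)
  let cL : Fin n → L := fun i ↦ ⟨c i, IntermediateField.subset_adjoin _ _ ⟨i, rfl⟩⟩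
  have hcL : (comb g cL).map L.val = comb g c := comb_map g cL L.val
  have heL : Module.finrank L (fac f (comb g cL)) = e := by
    have h := finrank_fac_map_eq f (comb g cL) (AlgHom.id k L) Function.injective_id L.val
      L.val.injective
    rw [hcL, he] at h
    exact h
  let W := Module.finBasisOfFinrankEq L _ heL
  have hWli : LinearIndependent Ω (fun j ↦ L.val ∘ (W j : Fin n → L)) := by
    have h0 := W.linearIndependent.map' _ (Submodule.ker_subtype _)
    obtain ⟨t, ht⟩ := exists_submatrix_det_ne_zero_of_linearIndependent (RingHom.id L)
      (of fun j ↦ (W j : Fin n → L)) h0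
    refine linearIndependent_row_of_submatrix_det_ne_zero
      ((of fun j ↦ (W j : Fin n → L)).map L.val) t ?_
    change (L.val.toRingHom.mapMatrix ((of fun j ↦ (W j : Fin n → L)).submatrix id t)).det ≠ 0
    rw [← RingHom.map_det]
    exact (map_ne_zero_iff _ L.val.injective).2 ht
  obtain ⟨z, hz⟩ := exists_sum_smul_eq_of_mem (w := fun j ↦ L.val ∘ (W j : Fin n → L)) he
    (fun j ↦ by
      obtain ⟨V, hV⟩ := (W j).2
      refine ⟨V.map L.val, ?_⟩
      rw [← comb_map, hV, ← hcL]
      exact Matrix.map_mul (f := L.val.toRingHom)) hWli hx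
  suffices hind : AlgebraicIndependent k (Sum.elim c z) from hind.comp Sum.inl Sum.inl_injective
  refine algebraicIndependent_of_forall_mem_adjoin hxy rfl ?_
  let T := IntermediateField.adjoin k (Set.range (Sum.elim c z))
  have hcT (i) : c i ∈ T := IntermediateField.subset_adjoin _ _ ⟨Sum.inl i, rfl⟩
  have hzT (i) : z i ∈ T := IntermediateField.subset_adjoin _ _ ⟨Sum.inr i, rfl⟩
  have hLT : L ≤ T := IntermediateField.adjoin_le_iff.2 (by rintro _ ⟨i, rfl⟩; exact hcT i)
  have hxT (i) : x i ∈ T := by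
    rw [← hz, Finset.sum_apply]
    exact sum_mem fun j _ ↦ mul_mem (hzT j) (hLT (Subtype.property _))
  have hpT (p : MvPolynomial (Fin n) k) : MvPolynomial.aeval x p ∈ T := by
    have : MvPolynomial.aeval x =
        T.val.comp (MvPolynomial.aeval fun i ↦ (⟨x i, hxT i⟩ : T)) := by
      ext i
      simp
    rw [this]
    exact Subtype.property _
  have hxind : AlgebraicIndependent k x := hxy.1.comp Sum.inl Sum.inl_injective
  rintro (i | i)
  · exact hxT i
  · refine mem_of_vecMul_mem T (((of β).submatrix id s).map (MvPolynomial.aeval (R := k) x))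
      (fun i j ↦ hpT _) ?_ y (fun j ↦ ?_) i
    · change ((MvPolynomial.aeval (R := k) x).toRingHom.mapMatrix _).det ≠ 0
      rw [← RingHom.map_det]
      exact (map_ne_zero_iff _ hxind).2 hs
    · convert hcT (s j) using 1
      rw [hc, Finset.sum_apply]
      rfl

theorem exists_le_rank_comb {k : Type*} [Field k] [Infinite k] {n : ℕ} {a b m : Type*}
    [Fintype a] [Fintype b] [Fintype m] (f : Fin n → Matrix a m k) (g : Fin n → Matrix b m k)
    (ρ : ℕ)
    (hfac : ∀ u : Fin n → k, Module.finrank k (fac f (comb f u)) =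
      Module.finrank k (fac g (comb f u)))
    (hlt : ∀ u : Fin n → k, (comb f u).rank < ρ →
      ∃ c ∈ fac g (comb f u), (comb g c).rank = (comb f u).rank)
    (c₀ : Fin n → k) (hc₀ : (comb g c₀).rank = ρ) :
    ∃ u : Fin n → k, ρ ≤ (comb f u).rank := by
  classical
  by_contra! hρ
  let F : Matrix a m (MvPolynomial (Fin n) k) := comb f MvPolynomial.X
  let φ : MvPolynomial (Fin n) k →ₐ[k] FractionRing (MvPolynomial (Fin n) k) :=
    IsScalarTower.toAlgHom k _ _
  have hφ : Function.Injective φ :=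
    IsFractionRing.injective (MvPolynomial (Fin n) k) (FractionRing (MvPolynomial (Fin n) k))
  obtain ⟨e, he⟩ :
      ∃ e, Module.finrank (FractionRing (MvPolynomial (Fin n) k)) (fac g (F.map φ)) = e := ⟨_, rfl⟩
  obtain ⟨β, U, hU, hli⟩ := exists_linearIndependent_fac
    (E := FractionRing (MvPolynomial (Fin n) k)) g F he
  obtain ⟨s, hs⟩ := exists_submatrix_det_ne_zero_of_linearIndependent (algebraMap _ _) (of β) hli
  obtain ⟨d₁, hd₁, h₁⟩ := exists_ne_zero_rank_map_eq (E' := k) F φ.toRingHom hφ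
  obtain ⟨d₂, hd₂, h₂⟩ := exists_ne_zero_finrank_fac_map_eq (E' := k) f F φ hφ
  obtain ⟨d₃, hd₃, h₃⟩ := exists_ne_zero_finrank_fac_map_eq (E' := k) g F φ hφ
  obtain ⟨u, hu⟩ := MvPolynomial.exists_aeval_ne_zero
    (mul_ne_zero hs (mul_ne_zero hd₁ (mul_ne_zero hd₂ hd₃)))
  simp only [map_mul, mul_ne_zero_iff] at hu
  obtain ⟨hus, hu₁, hu₂, hu₃⟩ := hu
  have hFu : F.map (MvPolynomial.aeval (R := k) u) = comb f u := aeval_X_map_comb f u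
  have h₁' : (comb f u).rank = (F.map φ).rank := by
    rw [← hFu]
    exact h₁ (MvPolynomial.aeval u).toRingHom hu₁
  replace h₂ := h₂ (MvPolynomial.aeval u) hu₂
  replace h₃ := h₃ (MvPolynomial.aeval u) hu₃
  rw [hFu] at h₂ h₃
  have heF :
      Module.finrank (FractionRing (MvPolynomial (Fin n) k)) (fac f (F.map φ)) = e := by
    rw [← h₂, hfac, h₃, he]
  obtain ⟨c₁, hc₁, hrc₁⟩ := hlt u (hρ u)
  have hβu : LinearIndependent k (fun i ↦ MvPolynomial.aeval u ∘ β i) := by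
    refine linearIndependent_row_of_submatrix_det_ne_zero
      ((of β).map (MvPolynomial.aeval (R := k) u)) s ?_
    change ((MvPolynomial.aeval u).toRingHom.mapMatrix ((of β).submatrix id s)).det ≠ 0
    rw [← RingHom.map_det]
    exact hus
  obtain ⟨v, hv⟩ := exists_sum_smul_eq_of_mem (h₃.trans he)
    (w := fun i ↦ MvPolynomial.aeval u ∘ β i) (fun i ↦ by
      refine ⟨(U i).map (MvPolynomial.aeval (R := k) u), ?_⟩
      rw [← comb_map, hU, ← hFu]
      exact Matrix.map_mul (f := (MvPolynomial.aeval (R := k) u).toRingHom)) hβu hc₁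
  obtain ⟨Ω, _, _, x, y, hxy⟩ : ∃ (Ω : Type _) (_ : Field Ω) (_ : Algebra k Ω) (x : Fin n → Ω)
      (y : Fin e → Ω), IsTranscendenceBasis k (Sum.elim x y) := by
    have : Algebra.IsAlgebraic (MvPolynomial (Fin n ⊕ Fin e) k)
        (FractionRing (MvPolynomial (Fin n ⊕ Fin e) k)) :=
      IsLocalization.isAlgebraic _ (nonZeroDivisors _)
    have h := (IsTranscendenceBasis.mvPolynomial (Fin n ⊕ Fin e) k).algebraMap_comp
      (A := FractionRing (MvPolynomial (Fin n ⊕ Fin e) k))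
    rw [← Sum.elim_comp_inl_inr (algebraMap _ _ ∘ MvPolynomial.X)] at h
    exact ⟨_, _, _, _, _, h⟩
  have hψ : AlgebraicIndependent k x := hxy.1.comp Sum.inl Sum.inl_injective
  have hFx : F.map (MvPolynomial.aeval (R := k) x) = comb f x := aeval_X_map_comb f x
  have hrF : (comb f x).rank = (F.map φ).rank := by
    rw [← hFx]
    exact (rank_map_le_rank_map F φ.toRingHom hφ (MvPolynomial.aeval x).toRingHom).antisymm
      (rank_map_le_rank_map F (MvPolynomial.aeval x).toRingHom hψ φ.toRingHom)
  obtain ⟨c, hc⟩ : ∃ c, c = ∑ j, y j • (MvPolynomial.aeval x ∘ β j) := ⟨_, rfl⟩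
  have hcU := comb_sum_smul_eq_mul (MvPolynomial.aeval x) g hU y
  rw [← hc, hFx] at hcU
  have hrc : (comb g c).rank = (comb f x).rank := by
    refine le_antisymm (hcU ▸ rank_mul_le_right _ _) ?_
    have := rank_comb_sum_smul_le g β hxy.1 u v
    rwa [hv, hrc₁, h₁', ← hrF, ← hc] at this
  have hfacc : fac f (comb g c) = fac f (comb f x) := fac_eq_of_rank_eq f hcU hrc
  have hcind : AlgebraicIndependent k c := by
    refine algebraicIndependent_of_mem_fac f g β s hs hxy hc ?_ ?_
    · rw [hfacc, ← hFx, finrank_fac_map_eq f F _ hψ φ hφ, heF]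
    · rw [hfacc]
      exact ⟨1, (Matrix.one_mul _).symm⟩
  have hfin := rank_map_le_rank_map (comb g (MvPolynomial.X : Fin n → MvPolynomial (Fin n) k))
    (MvPolynomial.aeval (R := k) c).toRingHom hcind (MvPolynomial.aeval (R := k) c₀).toRingHom
  change ((comb g MvPolynomial.X).map (MvPolynomial.aeval (R := k) c₀)).rank ≤
    ((comb g MvPolynomial.X).map (MvPolynomial.aeval (R := k) c)).rank at hfin
  rw [aeval_X_map_comb, aeval_X_map_comb, hc₀, hrc, hrF, ← h₁'] at hfin
  exact (hρ u).not_ge hfin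

end Matrix

namespace LinearMap

variable {k X M N : Type*} [Field k] [AddCommGroup X] [Module k X] [AddCommGroup M] [Module k M]
  [AddCommGroup N] [Module k N]

/-- The elements of a space `F` of linear maps that vanish on `K`. -/
def vanishingOn (F : Submodule k (X →ₗ[k] N)) (K : Submodule k X) : Submodule k (X →ₗ[k] N) where
  carrier := {f | f ∈ F ∧ K ≤ ker f}
  add_mem' := fun hf hg ↦ ⟨F.add_mem hf.1 hg.1, fun x hx ↦ by
    rw [mem_ker, add_apply, mem_ker.1 (hf.2 hx), mem_ker.1 (hg.2 hx), add_zero]⟩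
  zero_mem' := ⟨F.zero_mem, fun x _ ↦ rfl⟩
  smul_mem' := fun c f hf ↦ ⟨F.smul_mem c hf.1, fun x hx ↦ by
    rw [mem_ker, smul_apply, mem_ker.1 (hf.2 hx), smul_zero]⟩

theorem finrank_range_eq_of_ker_eq [FiniteDimensional k X] {f : X →ₗ[k] M} {g : X →ₗ[k] N}
    (h : ker f = ker g) : Module.finrank k (range f) = Module.finrank k (range g) := by
  have h1 := f.finrank_range_add_finrank_ker
  have h2 := g.finrank_range_add_finrank_ker
  rw [h] at h1
  lia

theorem ker_mulVecLin_toMatrix {ι μ : Type*} [Fintype ι] [DecidableEq ι] [Fintype μ]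
    (bX : Module.Basis ι k X) (bN : Module.Basis μ k N) (g : X →ₗ[k] N) :
    ker (toMatrix bX bN g).mulVecLin = (ker g).comap bX.equivFun.symm.toLinearMap := by
  ext v
  obtain ⟨x, rfl⟩ := bX.equivFun.surjective v
  simp [toMatrix_mulVec_repr]

theorem exists_toMatrix_eq_mul_iff {ι κ μ : Type*} [Fintype ι] [DecidableEq ι] [Fintype κ]
    [Fintype μ] (bX : Module.Basis ι k X) (bM : Module.Basis κ k M) (bN : Module.Basis μ k N)
    (f : X →ₗ[k] M) (g : X →ₗ[k] N) :
    (∃ U : Matrix μ κ k, toMatrix bX bN g = U * toMatrix bX bM f) ↔ ker f ≤ ker g := by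
  rw [Matrix.exists_eq_mul_iff_ker_le, ker_mulVecLin_toMatrix,
    ker_mulVecLin_toMatrix,
    Submodule.comap_le_comap_iff_of_surjective (f := bX.equivFun.symm.toLinearMap)
      bX.equivFun.symm.surjective]

theorem exists_ker_eq_of_forall_finrank_range_lt [Infinite k] [FiniteDimensional k X]
    [FiniteDimensional k M] [FiniteDimensional k N]
    (F : Submodule k (X →ₗ[k] N)) (G : Submodule k (X →ₗ[k] M))
    (hF : ∀ f ∈ F, Module.finrank k (vanishingOn F (ker f)) =
      Module.finrank k (vanishingOn G (ker f)))
    {g₀ : X →ₗ[k] M} (hg₀ : g₀ ∈ G) (h₀ : Module.finrank k (vanishingOn F (ker g₀)) =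
      Module.finrank k (vanishingOn G (ker g₀)))
    (hlt : ∀ f ∈ F, Module.finrank k (range f) < Module.finrank k (range g₀) →
      ∃ g ∈ G, ker g = ker f) :
    ∃ f ∈ F, ker f = ker g₀ := by
  classical
  let bF := Module.finBasisOfFinrankEq k (vanishingOn F (ker g₀)) h₀
  let bG := Module.finBasis k (vanishingOn G (ker g₀))
  let bX := Module.finBasis k X
  let bM := Module.finBasis k M
  let bN := Module.finBasis k N
  let lF := (vanishingOn F (ker g₀)).subtype ∘ₗ bF.equivFun.symm.toLinearMap
  let lG := (vanishingOn G (ker g₀)).subtype ∘ₗ bG.equivFun.symm.toLinearMap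
  have hlF (u) : lF u ∈ vanishingOn F (ker g₀) := (bF.equivFun.symm u).2
  have hlG (u) : lG u ∈ vanishingOn G (ker g₀) := (bG.equivFun.symm u).2
  have hlF' {f} (hf : f ∈ vanishingOn F (ker g₀)) : ∃ u, lF u = f :=
    ⟨bF.equivFun ⟨f, hf⟩, by simp [lF]⟩
  have hlG' {f} (hf : f ∈ vanishingOn G (ker g₀)) : ∃ u, lG u = f :=
    ⟨bG.equivFun ⟨f, hf⟩, by simp [lG]⟩
  let f := fun i ↦ toMatrix bX bN (bF i : X →ₗ[k] N)
  let g := fun i ↦ toMatrix bX bM (bG i : X →ₗ[k] M)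
  have hf (u) : Matrix.comb f u = toMatrix bX bN (lF u) := by
    ext p q
    simp [Matrix.comb_apply, f, lF, Module.Basis.equivFun_symm_apply, toMatrix_apply]
  have hg (u) : Matrix.comb g u = toMatrix bX bM (lG u) := by
    ext p q
    simp [Matrix.comb_apply, g, lG, Module.Basis.equivFun_symm_apply, toMatrix_apply]
  have hmF (u : _ → k) (c : _ → k) :
      c ∈ Matrix.fac f (Matrix.comb f u) ↔ ker (lF u) ≤ ker (lF c) := by
    rw [Matrix.mem_fac, hf, hf, exists_toMatrix_eq_mul_iff]
  have hmG (u : _ → k) (c : _ → k) :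
      c ∈ Matrix.fac g (Matrix.comb f u) ↔ ker (lF u) ≤ ker (lG c) := by
    rw [Matrix.mem_fac, hf, hg, exists_toMatrix_eq_mul_iff]
  have hrF (u : _ → k) : (Matrix.comb f u).rank = Module.finrank k (range (lF u)) := by
    rw [hf, Matrix.rank_eq_finrank_range_toLin _ bN bX, Matrix.toLin_toMatrix]
  have hrG (u : _ → k) : (Matrix.comb g u).rank = Module.finrank k (range (lG u)) := by
    rw [hg, Matrix.rank_eq_finrank_range_toLin _ bM bX, Matrix.toLin_toMatrix]
  have hiF : Function.Injective lF := Subtype.val_injective.comp bF.equivFun.symm.injective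
  have hiG : Function.Injective lG := Subtype.val_injective.comp bG.equivFun.symm.injective
  have hfF (u) : (Matrix.fac f (Matrix.comb f u)).map lF = vanishingOn F (ker (lF u)) := by
    ext h
    constructor
    · rintro ⟨c, hc, rfl⟩
      exact ⟨(hlF c).1, (hmF u c).1 hc⟩
    · intro hh
      obtain ⟨c, rfl⟩ := hlF' ⟨hh.1, (hlF u).2.trans hh.2⟩
      exact ⟨c, (hmF u c).2 hh.2, rfl⟩
  have hfG (u) : (Matrix.fac g (Matrix.comb f u)).map lG = vanishingOn G (ker (lF u)) := by
    ext h
    constructor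
    · rintro ⟨c, hc, rfl⟩
      exact ⟨(hlG c).1, (hmG u c).1 hc⟩
    · intro hh
      obtain ⟨c, rfl⟩ := hlG' ⟨hh.1, (hlF u).2.trans hh.2⟩
      exact ⟨c, (hmG u c).2 hh.2, rfl⟩
  obtain ⟨c₀, hc₀⟩ := hlG' ⟨hg₀, le_rfl⟩
  obtain ⟨u, hu⟩ := Matrix.exists_le_rank_comb f g (Module.finrank k (range g₀))
    (fun u ↦ by
      have h := hF _ (hlF u).1
      rwa [← hfF, ← hfG, ← (Submodule.equivMapOfInjective lF hiF _).finrank_eq,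
        ← (Submodule.equivMapOfInjective lG hiG _).finrank_eq] at h)
    (fun u hu ↦ by
      rw [hrF] at hu
      obtain ⟨h, hhG, hh⟩ := hlt _ (hlF u).1 hu
      obtain ⟨c, rfl⟩ := hlG' ⟨hhG, (hlF u).2.trans hh.ge⟩
      exact ⟨c, (hmG u c).2 hh.ge, by rw [hrF, hrG, finrank_range_eq_of_ker_eq hh]⟩)
    c₀ (by rw [hrG, hc₀])
  rw [hrF] at hu
  refine ⟨lF u, (hlF u).1, (Submodule.eq_of_le_of_finrank_le (hlF u).2 ?_).symm⟩
  have h1 := (lF u).finrank_range_add_finrank_ker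
  have h2 := g₀.finrank_range_add_finrank_ker
  lia

theorem exists_ker_eq_of_infinite [Infinite k] [FiniteDimensional k X]
    [FiniteDimensional k M] [FiniteDimensional k N]
    (F : Submodule k (X →ₗ[k] N)) (G : Submodule k (X →ₗ[k] M))
    (hF : ∀ f ∈ F, Module.finrank k (vanishingOn F (ker f)) =
      Module.finrank k (vanishingOn G (ker f)))
    (hG : ∀ g ∈ G, Module.finrank k (vanishingOn F (ker g)) =
      Module.finrank k (vanishingOn G (ker g)))
    {g : X →ₗ[k] M} (hg : g ∈ G) : ∃ f ∈ F, ker f = ker g := by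
  suffices h : ∀ r, (∀ g ∈ G, Module.finrank k (range g) = r → ∃ f ∈ F, ker f = ker g) ∧
      (∀ f ∈ F, Module.finrank k (range f) = r → ∃ g ∈ G, ker g = ker f) from
    (h _).1 g hg rfl
  intro r
  induction r using Nat.strong_induction_on with
  | _ r ih =>
    constructor
    · rintro g hg rfl
      exact exists_ker_eq_of_forall_finrank_range_lt F G hF hg (hG g hg)
        fun f hf hlt ↦ (ih _ hlt).2 f hf rfl
    · rintro f hf rfl
      exact exists_ker_eq_of_forall_finrank_range_lt G F (fun g hg ↦ (hG g hg).symm) hf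
        (hF f hf).symm fun g hg hlt ↦ (ih _ hlt).1 g hg rfl

theorem natCard_vanishingOn [Finite k] [FiniteDimensional k X] [FiniteDimensional k N]
    [Fintype (Submodule k X)] (F : Submodule k (X →ₗ[k] N)) (K : Submodule k X)
    [DecidablePred (K ≤ ·)] :
    Nat.card (vanishingOn F K) =
      ∑ L : Submodule k X with K ≤ L, Nat.card {f : X →ₗ[k] N // f ∈ F ∧ ker f = L} := by
  classical
  have : Finite (X →ₗ[k] N) := Module.finite_of_finite k
  have := Fintype.ofFinite (X →ₗ[k] N)
  have h := Finset.card_eq_sum_card_fiberwise (f := fun f : X →ₗ[k] N ↦ ker f)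
    (s := Finset.univ.filter (· ∈ vanishingOn F K)) (t := Finset.univ.filter (K ≤ ·))
    (fun f hf ↦ by simpa using (Finset.mem_filter.1 hf).2.2)
  change Nat.card {f // f ∈ vanishingOn F K} = _
  rw [Nat.card_eq_fintype_card, Fintype.card_subtype, h]
  refine Finset.sum_congr rfl fun L hL ↦ ?_
  rw [Nat.card_eq_fintype_card, Fintype.card_subtype, Finset.filter_filter]
  congr 1
  ext f
  simp only [Finset.mem_filter, Finset.mem_univ, true_and]
  constructor
  · rintro ⟨h1, h2⟩
    exact ⟨h1.1, h2⟩
  · rintro ⟨h1, rfl⟩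
    exact ⟨⟨h1, (Finset.mem_filter.1 hL).2⟩, rfl⟩

theorem exists_ker_eq_of_finite [Finite k] [FiniteDimensional k X]
    [FiniteDimensional k M] [FiniteDimensional k N]
    (F : Submodule k (X →ₗ[k] N)) (G : Submodule k (X →ₗ[k] M))
    (hF : ∀ f ∈ F, Module.finrank k (vanishingOn F (ker f)) =
      Module.finrank k (vanishingOn G (ker f)))
    (hG : ∀ g ∈ G, Module.finrank k (vanishingOn F (ker g)) =
      Module.finrank k (vanishingOn G (ker g)))
    {g : X →ₗ[k] M} (hg : g ∈ G) : ∃ f ∈ F, ker f = ker g := by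
  classical
  have : Finite X := Module.finite_of_finite k
  have : Finite (X →ₗ[k] N) := Module.finite_of_finite k
  have : Finite (X →ₗ[k] M) := Module.finite_of_finite k
  have : Finite (Submodule k X) := Finite.of_injective _ SetLike.coe_injective
  have := Fintype.ofFinite (Submodule k X)
  suffices h : ∀ K, Nat.card {f : X →ₗ[k] N // f ∈ F ∧ ker f = K} =
      Nat.card {g : X →ₗ[k] M // g ∈ G ∧ ker g = K} by
    have hpos : 0 < Nat.card {h : X →ₗ[k] M // h ∈ G ∧ ker h = ker g} :=
      Nat.card_pos_iff.2 ⟨⟨⟨g, hg, rfl⟩⟩, inferInstance⟩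
    rw [← h] at hpos
    obtain ⟨f, hf⟩ := (Nat.card_pos_iff.1 hpos).1
    exact ⟨f, hf⟩
  intro K
  induction K using WellFoundedGT.induction with
  | _ K ih =>
    have key (h : Module.finrank k (vanishingOn F K) = Module.finrank k (vanishingOn G K)) :
        Nat.card {f : X →ₗ[k] N // f ∈ F ∧ ker f = K} =
          Nat.card {g : X →ₗ[k] M // g ∈ G ∧ ker g = K} := by
      have hcard : Nat.card (vanishingOn F K) = Nat.card (vanishingOn G K) := by
        rw [Module.natCard_eq_pow_finrank (K := k), h, ← Module.natCard_eq_pow_finrank (K := k)]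
      have hK : K ∈ Finset.univ.filter (K ≤ ·) := by simp
      rw [natCard_vanishingOn, natCard_vanishingOn, ← Finset.add_sum_erase _ _ hK,
        ← Finset.add_sum_erase _ _ hK] at hcard
      rw [Finset.sum_congr rfl fun L hL ↦ ih L ?_] at hcard
      · exact Nat.add_right_cancel hcard
      · rw [Finset.mem_erase, Finset.mem_filter] at hL
        exact lt_of_le_of_ne hL.2.2 hL.1.symm
    by_cases h1 : ∃ f ∈ F, ker f = K
    · obtain ⟨f, hf, rfl⟩ := h1
      exact key (hF f hf)
    by_cases h2 : ∃ g ∈ G, ker g = K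
    · obtain ⟨g, hg, rfl⟩ := h2
      exact key (hG g hg)
    have e1 : IsEmpty {f : X →ₗ[k] N // f ∈ F ∧ ker f = K} := ⟨fun f ↦ h1 ⟨f, f.2⟩⟩
    have e2 : IsEmpty {g : X →ₗ[k] M // g ∈ G ∧ ker g = K} := ⟨fun g ↦ h2 ⟨g, g.2⟩⟩
    rw [Nat.card_of_isEmpty, Nat.card_of_isEmpty]

section Algebra

variable {A Y : Type*} [Ring A] [Algebra k A] [Module A X] [IsScalarTower k A X] [Module A M]
  [IsScalarTower k A M] [Module A N] [IsScalarTower k A N] [AddCommGroup Y] [Module k Y]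
  [Module A Y] [IsScalarTower k A Y]

variable (k A X N) in
/-- The `k`-linear maps that are `A`-linear. -/
def algHoms : Submodule k (X →ₗ[k] N) where
  carrier := {f | ∀ (a : A) (x : X), f (a • x) = a • f x}
  add_mem' := fun hf hg a x ↦ by rw [add_apply, add_apply, hf, hg, smul_add]
  zero_mem' := fun a x ↦ (smul_zero a).symm
  smul_mem' := fun c f hf a x ↦ by rw [smul_apply, smul_apply, hf, smul_comm]

/-- An element of `algHoms` as an `A`-linear map. -/
def ofMemAlgHoms {f : X →ₗ[k] N} (hf : f ∈ algHoms k X N A) : X →ₗ[A] N where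
  toFun := f
  map_add' := f.map_add
  map_smul' := hf

theorem finrank_vanishingOn_algHoms {f : X →ₗ[A] Y} (hf : Function.Surjective f) :
    Module.finrank k (vanishingOn (algHoms k X N A) (ker (f.restrictScalars k))) =
      Module.finrank k (Y →ₗ[A] N) := by
  let Φ : (Y →ₗ[A] N) →ₗ[k] (X →ₗ[k] N) :=
    { toFun := fun h ↦ (h ∘ₗ f).restrictScalars k
      map_add' := fun _ _ ↦ rfl
      map_smul' := fun _ _ ↦ rfl }
  have hΦ : Function.Injective Φ := fun h h' e ↦ by
    ext y
    obtain ⟨x, rfl⟩ := hf y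
    exact LinearMap.congr_fun e x
  rw [← finrank_range_of_inj hΦ]
  suffices vanishingOn (algHoms k X N A) (ker (f.restrictScalars k)) = range Φ by rw [this]
  ext h
  constructor
  · rintro ⟨h1, h2⟩
    refine ⟨(Submodule.liftQ (ker f) (ofMemAlgHoms h1) h2) ∘ₗ
      (f.quotKerEquivOfSurjective hf).symm.toLinearMap, ?_⟩
    ext x
    have : (f.quotKerEquivOfSurjective hf).symm (f x) = (ker f).mkQ x := by
      rw [LinearEquiv.symm_apply_eq]
      rfl
    change Submodule.liftQ (ker f) (ofMemAlgHoms h1) h2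
      ((f.quotKerEquivOfSurjective hf).symm (f x)) = h x
    rw [this]
    rfl
  · rintro ⟨h, rfl⟩
    exact ⟨fun a x ↦ (h ∘ₗ f).map_smul a x, fun x hx ↦ by
      have hx' : f x = 0 := hx
      change h (f x) = 0
      rw [hx', map_zero]⟩

theorem finrank_vanishingOn_ker {f : X →ₗ[k] M} (hf : f ∈ algHoms k X M A) :
    Module.finrank k (vanishingOn (algHoms k X N A) (ker f)) =
      Module.finrank k (range (ofMemAlgHoms hf) →ₗ[A] N) := by
  have hker : ker ((ofMemAlgHoms hf).rangeRestrict.restrictScalars k) = ker f := by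
    ext x
    exact Subtype.ext_iff
  rw [← hker, finrank_vanishingOn_algHoms (ofMemAlgHoms hf).surjective_rangeRestrict]

theorem exists_injective_of_finrank_eq [FiniteDimensional k M] [FiniteDimensional k N]
    (hM : ∀ X : Submodule A M, Module.finrank k (X →ₗ[A] M) = Module.finrank k (X →ₗ[A] N))
    (hN : ∀ X : Submodule A N, Module.finrank k (X →ₗ[A] M) = Module.finrank k (X →ₗ[A] N)) :
    ∃ f : M →ₗ[A] N, Function.Injective f := by
  have hF : ∀ f ∈ algHoms k M N A, Module.finrank k (vanishingOn (algHoms k M N A) (ker f)) =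
      Module.finrank k (vanishingOn (algHoms k M M A) (ker f)) := fun f hf ↦ by
    rw [finrank_vanishingOn_ker hf, finrank_vanishingOn_ker hf, hN]
  have hG : ∀ g ∈ algHoms k M M A, Module.finrank k (vanishingOn (algHoms k M N A) (ker g)) =
      Module.finrank k (vanishingOn (algHoms k M M A) (ker g)) := fun g hg ↦ by
    rw [finrank_vanishingOn_ker hg, finrank_vanishingOn_ker hg, hM]
  have hid : LinearMap.id ∈ algHoms k M M A := fun _ _ ↦ rfl
  obtain ⟨f, hf, hker⟩ : ∃ f ∈ algHoms k M N A, ker f = ker (LinearMap.id : M →ₗ[k] M) := by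
    rcases finite_or_infinite k with _ | _
    · exact exists_ker_eq_of_finite _ _ hF hG hid
    · exact exists_ker_eq_of_infinite _ _ hF hG hid
  exact ⟨ofMemAlgHoms hf, (ker_eq_bot (f := f)).1 (hker.trans ker_id)⟩

end Algebra

end LinearMap

theorem LinearEquiv.finrank_hom_eq (k : Type*) {A M N : Type*} [Field k] [Ring A] [Algebra k A]
    [AddCommGroup M] [Module A M] [Module k M] [IsScalarTower k A M]
    [AddCommGroup N] [Module A N] [Module k N] [IsScalarTower k A N]
    (e : M ≃ₗ[A] N) (X : Type*) [AddCommGroup X] [Module A X] :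
    Module.finrank k (X →ₗ[A] M) = Module.finrank k (X →ₗ[A] N) :=
  LinearEquiv.finrank_eq
    { toFun := fun f ↦ e.toLinearMap ∘ₗ f
      invFun := fun f ↦ e.symm.toLinearMap ∘ₗ f
      map_add' := fun f g ↦ LinearMap.comp_add f g e.toLinearMap
      map_smul' := fun c f ↦ LinearMap.ext fun x ↦
        LinearMap.map_smul_of_tower e.toLinearMap c (f x)
      left_inv := fun f ↦ LinearMap.ext fun x ↦ e.symm_apply_apply (f x)
      right_inv := fun f ↦ LinearMap.ext fun x ↦ e.apply_symm_apply (f x) }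

/-- Two finite-dimensional modules `M`, `N` over a `k`-algebra `A`
are isomorphic iff `dim_k Hom_A(X, M) = dim_k Hom_A(X, N)` for every submodule `X`
of `M` or of `N`. -/
theorem stmt1 {k A : Type*} [Field k] [Ring A] [Algebra k A]
    {M N : Type*}
    [AddCommGroup M] [Module A M] [Module k M] [IsScalarTower k A M]
    [AddCommGroup N] [Module A N] [Module k N] [IsScalarTower k A N]
    [FiniteDimensional k M] [FiniteDimensional k N] :
    Nonempty (M ≃ₗ[A] N) ↔
      ((∀ X : Submodule A M,
          Module.finrank k (X →ₗ[A] M) = Module.finrank k (X →ₗ[A] N)) ∧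
       (∀ X : Submodule A N,
          Module.finrank k (X →ₗ[A] M) = Module.finrank k (X →ₗ[A] N))) := by
  constructor
  · rintro ⟨e⟩
    exact ⟨fun X ↦ e.finrank_hom_eq k X, fun X ↦ e.finrank_hom_eq k X⟩
  · rintro ⟨hM, hN⟩
    obtain ⟨f, hf⟩ := LinearMap.exists_injective_of_finrank_eq hM hN
    obtain ⟨g, hg⟩ := LinearMap.exists_injective_of_finrank_eq (fun X ↦ (hN X).symm)
      (fun X ↦ (hM X).symm)
    have hle : Module.finrank k N ≤ Module.finrank k M :=
      LinearMap.finrank_le_finrank_of_injective (f := g.restrictScalars k) hg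
    have hge : Module.finrank k M ≤ Module.finrank k N :=
      LinearMap.finrank_le_finrank_of_injective (f := f.restrictScalars k) hf
    have hsurj : Function.Surjective (f.restrictScalars k) :=
      (LinearMap.injective_iff_surjective_of_finrank_eq_finrank (hge.antisymm hle)).1 hf
    exact ⟨LinearEquiv.ofBijective f ⟨hf, hsurj⟩⟩
end

section
/- Let k be a field and 𝒜 = k⟨X_1, …, X_p⟩ the free associative k-algebra in p non-commuting variables. Two 𝒜-modules M and N, each of k-dimension n, are isomorphic if and only if dim_k Hom_𝒜(M, X) = dim_k Hom_𝒜(N, X) holds for all 𝒜-modules X of k-dimension n. -/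
universe u

section HomDimension

variable {k : Type*} [Field k] {R : Type*} [Ring R] [Algebra k R]

/-- Every finite-dimensional module has a finite-dimensional space of homomorphisms. -/
theorem finiteDimensional_moduleHom (M X : Type*)
    [AddCommGroup M] [Module R M] [Module k M] [IsScalarTower k R M] [FiniteDimensional k M]
    [AddCommGroup X] [Module R X] [Module k X] [IsScalarTower k R X] [FiniteDimensional k X] :
    FiniteDimensional k (M →ₗ[R] X) :=
  FiniteDimensional.of_injective (LinearMap.restrictScalarsₗ k R M X k)
    (LinearMap.restrictScalars_injective k)

/-- Precomposition with an isomorphism, as an equivalence over the base field. -/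
def precompEquiv {M N : Type*} (X : Type*)
    [AddCommGroup M] [Module R M] [AddCommGroup N] [Module R N]
    [AddCommGroup X] [Module R X] [Module k X] [IsScalarTower k R X]
    (e : M ≃ₗ[R] N) : (M →ₗ[R] X) ≃ₗ[k] (N →ₗ[R] X) where
  toFun f := f ∘ₗ e.symm.toLinearMap
  invFun f := f ∘ₗ e.toLinearMap
  map_add' _ _ := rfl
  map_smul' _ _ := rfl
  left_inv f := by ext; simp
  right_inv f := by ext; simp

/-- Postcomposition with the inclusion of a submodule, as a linear map over the base field. -/
def postcompSubtype (M : Type*) {X : Type*}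
    [AddCommGroup M] [Module R M]
    [AddCommGroup X] [Module R X] [Module k X] [IsScalarTower k R X]
    (Y : Submodule R X) : (M →ₗ[R] Y) →ₗ[k] (M →ₗ[R] X) where
  toFun f := Y.subtype ∘ₗ f
  map_add' _ _ := rfl
  map_smul' _ _ := rfl

theorem postcompSubtype_injective (M : Type*) {X : Type*}
    [AddCommGroup M] [Module R M]
    [AddCommGroup X] [Module R X] [Module k X] [IsScalarTower k R X]
    (Y : Submodule R X) : Function.Injective (postcompSubtype (k := k) M Y) := by
  intro f g h
  ext x
  exact LinearMap.congr_fun h x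

theorem finrank_prod_moduleHom (A M X : Type*)
    [AddCommGroup A] [Module R A] [Module k A] [IsScalarTower k R A] [FiniteDimensional k A]
    [AddCommGroup M] [Module R M] [Module k M] [IsScalarTower k R M] [FiniteDimensional k M]
    [AddCommGroup X] [Module R X] [Module k X] [IsScalarTower k R X] [FiniteDimensional k X] :
    Module.finrank k (A × M →ₗ[R] X) =
      Module.finrank k (A →ₗ[R] X) + Module.finrank k (M →ₗ[R] X) := by
  have := finiteDimensional_moduleHom (k := k) (R := R) A X
  have := finiteDimensional_moduleHom (k := k) (R := R) M X
  rw [← Module.finrank_prod]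
  exact (LinearMap.coprodEquiv k (R := R) (M := A) (M₂ := M) (M₃ := X)).finrank_eq.symm

theorem finrank_moduleHom_prod (M X Y : Type*)
    [AddCommGroup M] [Module R M] [Module k M] [IsScalarTower k R M] [FiniteDimensional k M]
    [AddCommGroup X] [Module R X] [Module k X] [IsScalarTower k R X] [FiniteDimensional k X]
    [AddCommGroup Y] [Module R Y] [Module k Y] [IsScalarTower k R Y] [FiniteDimensional k Y] :
    Module.finrank k (M →ₗ[R] X × Y) =
      Module.finrank k (M →ₗ[R] X) + Module.finrank k (M →ₗ[R] Y) := by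
  have := finiteDimensional_moduleHom (k := k) (R := R) M X
  have := finiteDimensional_moduleHom (k := k) (R := R) M Y
  rw [← Module.finrank_prod]
  exact (LinearMap.prodEquiv k (R := R) (M := M) (M₂ := X) (M₃ := Y)).finrank_eq.symm

theorem finrank_moduleHom_pi (M X : Type*) (r : ℕ)
    [AddCommGroup M] [Module R M] [Module k M] [IsScalarTower k R M] [FiniteDimensional k M]
    [AddCommGroup X] [Module R X] [Module k X] [IsScalarTower k R X] [FiniteDimensional k X] :
    Module.finrank k (M →ₗ[R] Fin r → X) = r * Module.finrank k (M →ₗ[R] X) := by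
  have := finiteDimensional_moduleHom (k := k) (R := R) M X
  have e : (Fin r → M →ₗ[R] X) ≃ₗ[k] (M →ₗ[R] Fin r → X) :=
    { toFun := LinearMap.pi
      invFun := fun f i => LinearMap.proj i ∘ₗ f
      map_add' := fun _ _ => rfl
      map_smul' := fun _ _ => rfl
      left_inv := fun _ => rfl
      right_inv := fun _ => rfl }
  rw [← e.finrank_eq, Module.finrank_pi_fintype]
  simp

/-- If `M` and `N` have equally many maps to `B` and to `ker h`, and some map `M → B` is not
killed by `h`, then some map `N → B` is not killed by `h`. -/
theorem exists_comp_ne_zero_of_finrank_eq {M N B C : Type*}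
    [AddCommGroup M] [Module R M] [Module k M] [IsScalarTower k R M] [FiniteDimensional k M]
    [AddCommGroup N] [Module R N] [Module k N] [IsScalarTower k R N] [FiniteDimensional k N]
    [AddCommGroup B] [Module R B] [Module k B] [IsScalarTower k R B] [FiniteDimensional k B]
    [AddCommGroup C] [Module R C] (h : B →ₗ[R] C)
    (hB : Module.finrank k (M →ₗ[R] B) = Module.finrank k (N →ₗ[R] B))
    (hK : Module.finrank k (M →ₗ[R] h.ker) = Module.finrank k (N →ₗ[R] h.ker))
    (f : M →ₗ[R] B) (hf : h ∘ₗ f ≠ 0) : ∃ g : N →ₗ[R] B, h ∘ₗ g ≠ 0 := by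
  by_contra! H
  have : FiniteDimensional k h.ker :=
    inferInstanceAs (FiniteDimensional k (h.ker.restrictScalars k))
  have := finiteDimensional_moduleHom (k := k) (R := R) M B
  have := finiteDimensional_moduleHom (k := k) (R := R) N B
  have := finiteDimensional_moduleHom (k := k) (R := R) M h.ker
  have := finiteDimensional_moduleHom (k := k) (R := R) N h.ker
  have hN : Module.finrank k (N →ₗ[R] h.ker) = Module.finrank k (N →ₗ[R] B) := by
    refine (LinearEquiv.ofBijective (postcompSubtype (k := k) N h.ker)
      ⟨postcompSubtype_injective N _, fun g => ?_⟩).finrank_eq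
    exact ⟨g.codRestrict h.ker fun x => LinearMap.congr_fun (H g) x, by ext; rfl⟩
  obtain ⟨f', rfl⟩ := (LinearMap.injective_iff_surjective_of_finrank_eq_finrank
    (hK.trans (hN.trans hB.symm))).1 (postcompSubtype_injective (k := k) M h.ker) f
  exact hf (by ext x; exact (f' x).2)

/-- The endomorphism ring of a finite-dimensional module contains a nonzero `h` that lies in
`h ∘ a ∘ End M` whenever `h ∘ a` is nonzero: a generator of a minimal right ideal. -/
theorem exists_ne_zero_forall_comp_eq (k : Type*) [Field k] [Algebra k R] (M : Type*)
    [AddCommGroup M] [Module R M] [Module k M] [IsScalarTower k R M] [FiniteDimensional k M]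
    [Nontrivial M] :
    ∃ h : M →ₗ[R] M, h ≠ 0 ∧ ∀ a : M →ₗ[R] M, h ∘ₗ a ≠ 0 → ∃ b, h ∘ₗ a ∘ₗ b = h := by
  have := finiteDimensional_moduleHom (k := k) (R := R) M M
  let I (h : M →ₗ[R] M) : Submodule k (M →ₗ[R] M) :=
    { carrier := {f | ∃ b, h ∘ₗ b = f}
      add_mem' := by
        rintro _ _ ⟨b, rfl⟩ ⟨c, rfl⟩
        exact ⟨b + c, LinearMap.comp_add _ _ _⟩
      zero_mem' := ⟨0, LinearMap.comp_zero _⟩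
      smul_mem' := by
        rintro c _ ⟨b, rfl⟩
        exact ⟨c • b, by ext x; exact (h.restrictScalars k).map_smul c (b x)⟩ }
  obtain ⟨h, h0, hmin⟩ := (InvImage.wf I wellFounded_lt).has_min
    {h : M →ₗ[R] M | h ≠ 0} ⟨LinearMap.id, one_ne_zero (α := Module.End R M)⟩
  refine ⟨h, h0, fun a ha => ?_⟩
  have hle : I (h ∘ₗ a) ≤ I h := by
    rintro _ ⟨b, rfl⟩
    exact ⟨a ∘ₗ b, rfl⟩
  have heq : I (h ∘ₗ a) = I h := by
    by_contra hne
    exact hmin _ ha (lt_of_le_of_ne hle hne)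
  have : h ∈ I (h ∘ₗ a) := heq ▸ ⟨LinearMap.id, rfl⟩
  exact this

/-- If `g ∘ s` is not nilpotent, then `M` and `N` share a nonzero direct summand. -/
theorem exists_common_summand {M N : Type*}
    [AddCommGroup M] [Module R M] [IsArtinian R M] [IsNoetherian R M]
    [AddCommGroup N] [Module R N] [IsArtinian R N] [IsNoetherian R N]
    (g : N →ₗ[R] M) (s : M →ₗ[R] N)
    (h : ¬ IsNilpotent (g ∘ₗ s : Module.End R M)) :
    ∃ A M' : Submodule R M, ∃ N' : Submodule R N, A ≠ ⊥ ∧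
      Nonempty ((A × M') ≃ₗ[R] M) ∧ Nonempty ((A × N') ≃ₗ[R] N) := by
  let a : Module.End R M := g ∘ₗ s
  let b : Module.End R N := s ∘ₗ g
  obtain ⟨m, ha, hb, hm⟩ := (a.eventually_isCompl_ker_pow_range_pow.and
    (b.eventually_isCompl_ker_pow_range_pow.and (Filter.eventually_ge_atTop 1))).exists
  have hs (j : ℕ) (x : M) : s ((a ^ j) x) = (b ^ j) (s x) := by
    induction j generalizing x with
    | zero => rfl
    | succ j ih => rw [pow_succ, pow_succ, Module.End.mul_apply, ih]; rfl
  have hg (j : ℕ) (x : N) : g ((b ^ j) x) = (a ^ j) (g x) := by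
    induction j generalizing x with
    | zero => rfl
    | succ j ih => rw [pow_succ, pow_succ, Module.End.mul_apply, ih]; rfl
  let s' : (a ^ m).range →ₗ[R] (b ^ m).range := s.restrict (by
    rintro _ ⟨x, rfl⟩
    exact ⟨s x, (hs m x).symm⟩)
  obtain ⟨l, rfl⟩ : ∃ l, m = l + 1 := ⟨m - 1, by omega⟩
  have hinj : Function.Injective s' := by
    rw [← LinearMap.ker_eq_bot, LinearMap.ker_eq_bot']
    rintro ⟨x, hx⟩ h0
    have hsx : s x = 0 := congrArg Subtype.val h0
    have hax : (a ^ (l + 1)) x = 0 := by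
      rw [pow_succ, Module.End.mul_apply]
      change (a ^ l) (g (s x)) = 0
      rw [hsx, map_zero, map_zero]
    exact Subtype.ext (Submodule.disjoint_def.1 ha.disjoint x hax hx)
  have hsurj : Function.Surjective s' := by
    rintro ⟨_, y, rfl⟩
    obtain ⟨y₁, hy₁, y₂, hy₂, rfl⟩ := Submodule.mem_sup.1
      (hb.sup_eq_top ▸ Submodule.mem_top : y ∈ (b ^ (l + 1)).ker ⊔ (b ^ (l + 1)).range)
    obtain ⟨z, rfl⟩ := hy₂
    have hcomm : (b ^ l) ((b ^ (l + 1)) z) = (b ^ (l + 1)) ((b ^ l) z) := by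
      rw [← Module.End.mul_apply, ← Module.End.mul_apply, ← pow_add, ← pow_add, add_comm]
    refine ⟨⟨g ((b ^ l) ((b ^ (l + 1)) z)), g ((b ^ l) z), ?_⟩, Subtype.ext ?_⟩
    · rw [hcomm, hg (l + 1)]
    · change b ((b ^ l) ((b ^ (l + 1)) z)) = (b ^ (l + 1)) (y₁ + (b ^ (l + 1)) z)
      rw [map_add, LinearMap.mem_ker.1 hy₁, zero_add, ← Module.End.mul_apply, ← pow_succ']
  refine ⟨(a ^ (l + 1)).range, (a ^ (l + 1)).ker, (b ^ (l + 1)).ker, fun h0 => ?_, ⟨?_⟩, ⟨?_⟩⟩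
  · exact h ⟨l + 1, LinearMap.range_eq_bot.1 h0⟩
  · exact Submodule.prodEquivOfIsCompl _ _ ha.symm
  · exact ((LinearEquiv.ofBijective s' ⟨hinj, hsurj⟩).prodCongr (.refl R _)).trans
      (Submodule.prodEquivOfIsCompl _ _ hb.symm)

/-- Modules of dimension at most `d` with equally many maps to every module of dimension at
most `d` are isomorphic. -/
theorem nonempty_equiv_of_finrank_moduleHom_eq (d : ℕ) {M N : Type u}
    [AddCommGroup M] [Module R M] [Module k M] [IsScalarTower k R M] [FiniteDimensional k M]
    [AddCommGroup N] [Module R N] [Module k N] [IsScalarTower k R N] [FiniteDimensional k N]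
    (hM : Module.finrank k M ≤ d) (hN : Module.finrank k N ≤ d)
    (H : ∀ (X : Type u) [AddCommGroup X] [Module R X] [Module k X] [IsScalarTower k R X]
      [FiniteDimensional k X], Module.finrank k X ≤ d →
      Module.finrank k (M →ₗ[R] X) = Module.finrank k (N →ₗ[R] X)) :
    Nonempty (M ≃ₗ[R] N) := by
  induction hr : Module.finrank k M using Nat.strong_induction_on generalizing M N with
  | _ r ih =>
  have fdSub {B : Type u} [AddCommGroup B] [Module R B] [Module k B] [IsScalarTower k R B]
      [FiniteDimensional k B] (Y : Submodule R B) : FiniteDimensional k Y :=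
    inferInstanceAs (FiniteDimensional k (Y.restrictScalars k))
  have leSub {B : Type u} [AddCommGroup B] [Module R B] [Module k B] [IsScalarTower k R B]
      [FiniteDimensional k B] (Y : Submodule R B) : Module.finrank k Y ≤ Module.finrank k B :=
    Submodule.finrank_le (Y.restrictScalars k)
  rcases subsingleton_or_nontrivial M with hsub | hnon
  · have := finiteDimensional_moduleHom (k := k) (R := R) N N
    have hNN := H N hN
    rw [Module.finrank_zero_of_subsingleton] at hNN
    have := Module.finrank_zero_iff.1 hNN.symm
    have : Subsingleton N := ⟨fun x y => by
      have h := LinearMap.congr_fun (Subsingleton.elim (LinearMap.id : N →ₗ[R] N) 0)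
      exact (h x).trans (h y).symm⟩
    exact ⟨0⟩
  obtain ⟨h, h0, hmin⟩ := exists_ne_zero_forall_comp_eq (R := R) k M
  obtain ⟨g, hgne⟩ := exists_comp_ne_zero_of_finrank_eq h (H M hM)
    (H h.ker ((leSub _).trans hM)) LinearMap.id h0
  obtain ⟨g', hg'ne⟩ := exists_comp_ne_zero_of_finrank_eq (h ∘ₗ g) (H N hN).symm
    (H (h ∘ₗ g).ker ((leSub _).trans hN)).symm LinearMap.id hgne
  obtain ⟨c, hc⟩ := hmin (g ∘ₗ g') hg'ne
  have hnil : ¬ IsNilpotent (g ∘ₗ (g' ∘ₗ c) : Module.End R M) := by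
    rintro ⟨m, hm⟩
    have hpow (j : ℕ) : (h : Module.End R M) * (g ∘ₗ (g' ∘ₗ c) : Module.End R M) ^ j = h := by
      induction j with
      | zero => exact mul_one _
      | succ j ihj => rw [pow_succ, ← mul_assoc, ihj]; exact hc
    exact h0 ((hpow m).symm.trans (by rw [hm, mul_zero]))
  have := isArtinian_of_tower (M := M) k (inferInstance : IsArtinian k M) (S := R)
  have := isNoetherian_of_tower (M := M) k (inferInstance : IsNoetherian k M) (S := R)
  have := isArtinian_of_tower (M := N) k (inferInstance : IsArtinian k N) (S := R)
  have := isNoetherian_of_tower (M := N) k (inferInstance : IsNoetherian k N) (S := R)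
  obtain ⟨A, M', N', hA, ⟨eM⟩, ⟨eN⟩⟩ := exists_common_summand g (g' ∘ₗ c) hnil
  have hlt : Module.finrank k M' < r := by
    have : Nontrivial A := Submodule.nontrivial_iff_ne_bot.2 hA
    have hpos : 0 < Module.finrank k A := Module.finrank_pos
    have hsum := (eM.restrictScalars k).finrank_eq
    rw [Module.finrank_prod] at hsum
    omega
  obtain ⟨e⟩ := ih _ hlt (M := M') (N := N') ((leSub _).trans hM) ((leSub _).trans hN)
    (fun X _ _ _ _ _ hX => by
      have hX := H X hX
      rw [← (precompEquiv (k := k) X eM).finrank_eq, ← (precompEquiv (k := k) X eN).finrank_eq,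
        finrank_prod_moduleHom, finrank_prod_moduleHom] at hX
      exact Nat.add_left_cancel hX) rfl
  exact ⟨eM.symm.trans (((LinearEquiv.refl R A).prodCongr e).trans eN)⟩

/-- Over an augmented algebra, equality of dimensions of homomorphism spaces to all modules of
dimension `n` implies the same for all modules of dimension at most `n`. -/
theorem finrank_moduleHom_eq_of_le {k : Type u} [Field k] [Algebra k R] (ε : R →ₐ[k] k) (n : ℕ)
    {M N : Type*}
    [AddCommGroup M] [Module R M] [Module k M] [IsScalarTower k R M] [FiniteDimensional k M]
    [AddCommGroup N] [Module R N] [Module k N] [IsScalarTower k R N] [FiniteDimensional k N]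
    (H : ∀ (X : Type u) [AddCommGroup X] [Module R X] [Module k X] [IsScalarTower k R X]
      [FiniteDimensional k X], Module.finrank k X = n →
      Module.finrank k (M →ₗ[R] X) = Module.finrank k (N →ₗ[R] X))
    (X : Type u) [AddCommGroup X] [Module R X] [Module k X] [IsScalarTower k R X]
    [FiniteDimensional k X] (hX : Module.finrank k X ≤ n) :
    Module.finrank k (M →ₗ[R] X) = Module.finrank k (N →ₗ[R] X) := by
  let _ : Module R k := Module.compHom k ε.toRingHom
  have : IsScalarTower k R k := ⟨fun c x y => by
    change ε (c • x) * y = c * (ε x * y)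
    rw [map_smul, smul_eq_mul, mul_assoc]⟩
  obtain ⟨r, hr⟩ := Nat.exists_eq_add_of_le hX
  have hpad := H (X × (Fin r → k)) (by rw [Module.finrank_prod, Module.finrank_fin_fun, hr])
  have hn := H (Fin n → k) (Module.finrank_fin_fun k)
  rw [finrank_moduleHom_prod, finrank_moduleHom_prod, finrank_moduleHom_pi,
    finrank_moduleHom_pi] at hpad
  rw [finrank_moduleHom_pi, finrank_moduleHom_pi] at hn
  rcases Nat.eq_zero_or_pos r with rfl | hpos
  · simpa using hpad
  · rw [Nat.eq_of_mul_eq_mul_left (by omega) hn] at hpad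
    exact Nat.add_right_cancel hpad

end HomDimension


/-- Over the free associative algebra `𝒜 = k⟨X_1,…,X_p⟩`, two modules
`M`, `N` of `k`-dimension `n` are isomorphic iff `dim_k Hom_𝒜(M, X) = dim_k Hom_𝒜(N, X)`
for all `𝒜`-modules `X` of `k`-dimension `n`. -/
theorem stmt3 {k : Type u} [Field k] (p n : ℕ)
    {M N : Type u}
    [AddCommGroup M] [Module (FreeAlgebra k (Fin p)) M] [Module k M]
    [IsScalarTower k (FreeAlgebra k (Fin p)) M]
    [AddCommGroup N] [Module (FreeAlgebra k (Fin p)) N] [Module k N]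
    [IsScalarTower k (FreeAlgebra k (Fin p)) N]
    [FiniteDimensional k M] [FiniteDimensional k N]
    (hM : Module.finrank k M = n) (hN : Module.finrank k N = n) :
    Nonempty (M ≃ₗ[FreeAlgebra k (Fin p)] N) ↔
      ∀ (X : Type u) [AddCommGroup X] [Module (FreeAlgebra k (Fin p)) X] [Module k X]
        [IsScalarTower k (FreeAlgebra k (Fin p)) X] [FiniteDimensional k X],
        Module.finrank k X = n →
        Module.finrank k (M →ₗ[FreeAlgebra k (Fin p)] X) =
          Module.finrank k (N →ₗ[FreeAlgebra k (Fin p)] X) := by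
  constructor
  · rintro ⟨e⟩ X _ _ _ _ _ _
    exact (precompEquiv (k := k) X e).finrank_eq
  · intro H
    exact nonempty_equiv_of_finrank_moduleHom_eq n hM.le hN.le
      (finrank_moduleHom_eq_of_le (FreeAlgebra.lift k 0) n H)
end

section
/- Let k be a field and A = (A_1, …, A_p), B = (B_1, …, B_p) two p-tuples of n×n matrices over k. Then A and B are simultaneously similar if and only if for every p-tuple Y = (Y_1, …, Y_p) of n×n matrices over k, the k-dimension of the space {Z ∈ k^{n×n} : Z A_i = Y_i Z for all i ∈ [p]} equals the k-dimension of the space {Z ∈ k^{n×n} : Z B_i = Y_i Z for all i ∈ [p]}. -/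
open Matrix

/-- The `k`-subspace `{Z ∈ k^{n×n} : Z * A i = C i * Z for all i}` of intertwiners
between the tuples `A` and `C`. -/
def intertwinerSpace {k : Type*} [Field k] {n p : ℕ}
    (A C : Fin p → Matrix (Fin n) (Fin n) k) :
    Submodule k (Matrix (Fin n) (Fin n) k) where
  carrier := {Z | ∀ i, Z * A i = C i * Z}
  add_mem' := by
    intro a b ha hb
    intro i
    simp only [Matrix.add_mul, Matrix.mul_add, ha i, hb i]
  zero_mem' := by intro i; simp
  smul_mem' := by
    intro c a ha
    intro i
    simp only [Matrix.smul_mul, Matrix.mul_smul, ha i]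

section HomDimension

universe u

variable {k R : Type*} [Field k] [Ring R] [Algebra k R]

section

variable {A B Y : Type*}
  [AddCommGroup A] [Module k A] [Module R A] [IsScalarTower k R A]
  [AddCommGroup B] [Module k B] [Module R B] [IsScalarTower k R B]
  [AddCommGroup Y] [Module k Y] [Module R Y] [IsScalarTower k R Y]

/-- Homomorphisms between finite-dimensional modules form a finite-dimensional space. -/
theorem finite_linearMap_of_tower [Module.Finite k A] [Module.Finite k Y] :
    Module.Finite k (A →ₗ[R] Y) :=
  Module.Finite.of_injective (LinearMap.restrictScalarsₗ k R A Y k)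
    (LinearMap.restrictScalars_injective k)

/-- If `Hom(A, -)` and `Hom(B, -)` have equal dimensions on `A` and on the trace of `B` in `A`,
then `A` is generated by `B`. -/
theorem iSup_range_eq_top_of_finrank_hom_eq_s4 [Module.Finite k A] [Module.Finite k B]
    (hA : Module.finrank k (A →ₗ[R] A) = Module.finrank k (B →ₗ[R] A))
    (hU : Module.finrank k (A →ₗ[R] (⨆ g : B →ₗ[R] A, LinearMap.range g : Submodule R A)) =
      Module.finrank k (B →ₗ[R] (⨆ g : B →ₗ[R] A, LinearMap.range g : Submodule R A))) :
    (⨆ g : B →ₗ[R] A, LinearMap.range g) = ⊤ := by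
  set U : Submodule R A := ⨆ g : B →ₗ[R] A, LinearMap.range g with hUdef
  have : Module.Finite k U := inferInstanceAs (Module.Finite k (U.restrictScalars k))
  have := finite_linearMap_of_tower (k := k) (R := R) (A := A) (Y := A)
  have := finite_linearMap_of_tower (k := k) (R := R) (A := A) (Y := U)
  have := finite_linearMap_of_tower (k := k) (R := R) (A := B) (Y := A)
  let postA : (A →ₗ[R] U) →ₗ[k] (A →ₗ[R] A) :=
    { toFun := fun f => U.subtype ∘ₗ f
      map_add' := fun _ _ => rfl
      map_smul' := fun _ _ => rfl }
  have hinj : Function.Injective postA := fun f g h =>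
    LinearMap.ext fun x => Subtype.ext (LinearMap.congr_fun h x)
  let restrictB : (B →ₗ[R] A) →ₗ[k] (B →ₗ[R] U) :=
    { toFun := fun g => g.codRestrict U fun x =>
        (le_iSup (fun g : B →ₗ[R] A => LinearMap.range g) g) ⟨x, rfl⟩
      map_add' := fun _ _ => rfl
      map_smul' := fun _ _ => rfl }
  have := finite_linearMap_of_tower (k := k) (R := R) (A := B) (Y := U)
  have hrestr : Function.Injective restrictB := fun f g h =>
    LinearMap.ext fun x => congrArg Subtype.val (LinearMap.congr_fun h x)
  have hle := LinearMap.finrank_le_finrank_of_injective hrestr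
  have heq : Module.finrank k (A →ₗ[R] U) = Module.finrank k (A →ₗ[R] A) :=
    le_antisymm (LinearMap.finrank_le_finrank_of_injective hinj) (by omega)
  obtain ⟨f, hf⟩ := ((LinearMap.injective_iff_surjective_of_finrank_eq_finrank heq).1 hinj)
    LinearMap.id
  refine eq_top_iff.2 fun x _ => ?_
  have hx : ((f x : U) : A) = x := LinearMap.congr_fun hf x
  exact hx ▸ (f x).2

/-- A retraction `r` of `j` splits off the kernel of `r` as a complementary summand. -/
def prodKerEquivOfLeftInverse {M : Type*} [AddCommGroup M] [Module R M]
    (j : M →ₗ[R] B) (r : B →ₗ[R] M) (h : r ∘ₗ j = LinearMap.id) :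
    (M × LinearMap.ker r) ≃ₗ[R] B :=
  have h' : ∀ x, r (j x) = x := fun x => LinearMap.congr_fun h x
  LinearEquiv.ofLinearMap (j.coprod (LinearMap.ker r).subtype)
    (r.prod ((LinearMap.id - j ∘ₗ r).codRestrict (LinearMap.ker r) fun x => by simp [h']))
    (by ext x; simp)
    (by
      apply LinearMap.ext
      rintro ⟨x, y, hy⟩
      rw [LinearMap.mem_ker] at hy
      ext <;> simp [h', hy])

theorem finrank_hom_prod [Module.Finite k A] [Module.Finite k B] [Module.Finite k Y] :
    Module.finrank k (A × B →ₗ[R] Y) =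
      Module.finrank k (A →ₗ[R] Y) + Module.finrank k (B →ₗ[R] Y) := by
  have := finite_linearMap_of_tower (k := k) (R := R) (A := A) (Y := Y)
  have := finite_linearMap_of_tower (k := k) (R := R) (A := B) (Y := Y)
  rw [← (LinearMap.coprodEquiv (R := R) (M := A) (M₂ := B) (M₃ := Y) k).finrank_eq,
    Module.finrank_prod]

theorem finrank_hom_prod_right {W : Type*} [Module.Finite k A] [Module.Finite k Y]
    [AddCommGroup W] [Module k W] [Module R W] [IsScalarTower k R W] [Module.Finite k W] :
    Module.finrank k (A →ₗ[R] Y × W) =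
      Module.finrank k (A →ₗ[R] Y) + Module.finrank k (A →ₗ[R] W) := by
  have := finite_linearMap_of_tower (k := k) (R := R) (A := A) (Y := Y)
  have := finite_linearMap_of_tower (k := k) (R := R) (A := A) (Y := W)
  rw [← (LinearMap.prodEquiv (R := R) (M := A) (M₂ := Y) (M₃ := W) k).finrank_eq,
    Module.finrank_prod]

theorem finrank_hom_pi (m : ℕ) [Module.Finite k A] [Module.Finite k Y] :
    Module.finrank k (A →ₗ[R] (Fin m → Y)) = m * Module.finrank k (A →ₗ[R] Y) := by
  have := finite_linearMap_of_tower (k := k) (R := R) (A := A) (Y := Y)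
  let e : (Fin m → (A →ₗ[R] Y)) ≃ₗ[k] (A →ₗ[R] (Fin m → Y)) :=
    { toFun := LinearMap.pi
      map_add' := fun _ _ => rfl
      map_smul' := fun _ _ => rfl
      invFun := fun f i => LinearMap.proj i ∘ₗ f
      left_inv := fun _ => rfl
      right_inv := fun _ => rfl }
  rw [← e.finrank_eq, Module.finrank_pi_fintype]
  simp

end

section

variable {A B : Type*} [AddCommGroup A] [Module k A] [Module R A] [IsScalarTower k R A]
  [AddCommGroup B] [Module R B]

/-- If two modules generate each other, some composite `A → B → A` lies outside the radical of
`End A`. -/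
theorem exists_comp_notMem_jacobson [Module.Finite k A] [Nontrivial A]
    (hA : (⨆ g : B →ₗ[R] A, LinearMap.range g) = ⊤)
    (hB : (⨆ f : A →ₗ[R] B, LinearMap.range f) = ⊤) :
    ∃ (f : A →ₗ[R] B) (g : B →ₗ[R] A),
      (g ∘ₗ f : Module.End R A) ∉ Ring.jacobson (Module.End R A) := by
  by_contra! hJ
  let N : Submodule (Module.End R A) A := Ring.jacobson (Module.End R A) • ⊤
  let N' : Submodule R A :=
    { N.toAddSubmonoid with
      smul_mem' := fun c x hx => by
        change x ∈ N at hx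
        change c • x ∈ N
        induction hx using Submodule.smul_induction_on' with
        | smul r hr n hn =>
          rw [Module.End.smul_def, ← map_smul, ← Module.End.smul_def]
          exact Submodule.smul_mem_smul hr trivial
        | add x _ y _ hx hy => rw [smul_add]; exact N.add_mem hx hy }
  have : Module.Finite (Module.End R A) A := Module.Finite.of_restrictScalars_finite k _ _
  have hlt : N < ⊤ := Submodule.jacobson_smul_lt_top ⊤
  refine hlt.ne (eq_top_iff.2 fun x _ => ?_)
  have key : (⊤ : Submodule R A) ≤ N' := by
    rw [← hA]
    refine iSup_le fun g => ?_
    rw [LinearMap.range_eq_map, ← hB, Submodule.map_iSup]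
    refine iSup_le fun f => ?_
    rintro _ ⟨_, ⟨a, rfl⟩, rfl⟩
    have hmem : (g ∘ₗ f : Module.End R A) • a ∈ N :=
      Submodule.smul_mem_smul (hJ f g) Submodule.mem_top
    exact hmem
  exact key (Submodule.mem_top (x := x))

/-- Two nonzero modules that generate each other have a common nonzero direct summand. -/
theorem exists_common_summand_s4 [Module.Finite k A] [Nontrivial A]
    (hA : (⨆ g : B →ₗ[R] A, LinearMap.range g) = ⊤)
    (hB : (⨆ f : A →ₗ[R] B, LinearMap.range f) = ⊤) :
    ∃ M : Submodule R A, M ≠ ⊥ ∧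
      (∃ r : A →ₗ[R] M, r ∘ₗ M.subtype = LinearMap.id) ∧
      ∃ (j : M →ₗ[R] B) (r : B →ₗ[R] M), r ∘ₗ j = LinearMap.id := by
  have : IsArtinian R A := isArtinian_of_tower k inferInstance
  have : IsNoetherian R A := isNoetherian_of_tower k inferInstance
  obtain ⟨f, g₀, hfg⟩ := exists_comp_notMem_jacobson (k := k) hA hB
  rw [← Ideal.jacobson_bot, Ideal.mem_jacobson_iff] at hfg
  push Not at hfg
  obtain ⟨y, hy⟩ := hfg
  let g : B →ₗ[R] A := -(y ∘ₗ g₀)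
  let u : Module.End R A := g ∘ₗ f
  have hu : ∃ a : A, a ≠ 0 ∧ u a = a := by
    by_contra! hfix
    have hinj : Function.Injective (1 - u : Module.End R A) := by
      rw [← LinearMap.ker_eq_bot, LinearMap.ker_eq_bot']
      intro a ha
      by_contra h0
      exact hfix a h0 (sub_eq_zero.1 ha).symm
    let e := LinearEquiv.ofBijective _ (IsArtinian.bijective_of_injective_endomorphism _ hinj)
    refine hy e.symm.toLinearMap ?_
    rw [Submodule.mem_bot]
    ext a
    have := e.symm_apply_apply a
    have he : e a = a + y (g₀ (f a)) := by
      simp [e, u, g]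
    rw [he, map_add] at this
    simp only [LinearMap.sub_apply, LinearMap.add_apply, Module.End.mul_apply,
      LinearEquiv.coe_coe, LinearMap.comp_apply, Module.End.one_apply, LinearMap.zero_apply]
    rw [add_comm, this, sub_self]
  obtain ⟨a, ha0, hua⟩ := hu
  obtain ⟨m, hm, hcompl⟩ := ((Filter.eventually_ge_atTop 1).and
    u.eventually_isCompl_ker_pow_range_pow).exists
  let M := LinearMap.range (u ^ m)
  have hpow : ∀ i, (u ^ i) a = a := fun i => by
    induction i with
    | zero => simp
    | succ i ih => rw [pow_succ, Module.End.mul_apply, hua, ih]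
  have hM : ∀ x ∈ M, (u ^ m) x = 0 → x = 0 := fun x hx h0 =>
    (Submodule.disjoint_def.1 hcompl.disjoint) x h0 hx
  let ρ : A →ₗ[R] M := (u ^ m).rangeRestrict
  have huM : ∀ x ∈ M, u x ∈ M := by
    rintro _ ⟨z, rfl⟩
    exact ⟨u z, by rw [← Module.End.mul_apply, ← Module.End.mul_apply, pow_mul_comm']⟩
  have h₁ : Function.Injective (ρ ∘ₗ M.subtype) := by
    rw [← LinearMap.ker_eq_bot, LinearMap.ker_eq_bot']
    intro x hx
    exact Subtype.ext (hM x x.2 (congrArg Subtype.val hx))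
  have h₂ : Function.Injective (ρ ∘ₗ u ∘ₗ M.subtype) := by
    rw [← LinearMap.ker_eq_bot, LinearMap.ker_eq_bot']
    intro x hx
    have hux : u x = 0 := hM _ (huM x x.2) (congrArg Subtype.val hx)
    refine Subtype.ext (hM x x.2 ?_)
    obtain ⟨i, rfl⟩ := Nat.exists_eq_add_of_le' hm
    rw [pow_succ, Module.End.mul_apply, hux, map_zero]
  let e₁ := LinearEquiv.ofBijective _ (IsArtinian.bijective_of_injective_endomorphism _ h₁)
  let e₂ := LinearEquiv.ofBijective _ (IsArtinian.bijective_of_injective_endomorphism _ h₂)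
  refine ⟨M, fun hbot => ha0 ?_, ⟨e₁.symm.toLinearMap ∘ₗ ρ, ?_⟩, f ∘ₗ M.subtype,
    e₂.symm.toLinearMap ∘ₗ ρ ∘ₗ g, ?_⟩
  · have : a ∈ M := ⟨a, hpow m⟩
    rwa [hbot, Submodule.mem_bot] at this
  · exact LinearMap.ext fun x => e₁.symm_apply_apply x
  · exact LinearMap.ext fun x => e₂.symm_apply_apply x

end

/-- Finite-dimensional modules `A` and `B` of dimension at most `N` are isomorphic as soon as
`Hom(A, -)` and `Hom(B, -)` have equal dimensions on all modules of dimension at most `N`. -/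
theorem nonempty_linearEquiv_of_finrank_hom_eq_s4 (N : ℕ) (A B : Type u)
    [AddCommGroup A] [Module k A] [Module R A] [IsScalarTower k R A] [Module.Finite k A]
    [AddCommGroup B] [Module k B] [Module R B] [IsScalarTower k R B] [Module.Finite k B]
    (hAN : Module.finrank k A ≤ N) (hBN : Module.finrank k B ≤ N)
    (h : ∀ (Y : Type u) [AddCommGroup Y] [Module k Y] [Module R Y] [IsScalarTower k R Y]
      [Module.Finite k Y], Module.finrank k Y ≤ N →
        Module.finrank k (A →ₗ[R] Y) = Module.finrank k (B →ₗ[R] Y)) :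
    Nonempty (A ≃ₗ[R] B) := by
  induction hd : Module.finrank k A using Nat.strong_induction_on generalizing A B with
  | _ d ih =>
  subst hd
  have := finite_linearMap_of_tower (k := k) (R := R) (A := A) (Y := B)
  have := finite_linearMap_of_tower (k := k) (R := R) (A := B) (Y := B)
  rcases subsingleton_or_nontrivial A with hA | hA
  · have h0 : Module.finrank k (B →ₗ[R] B) = 0 := by
      rw [← h B hBN]
      exact Module.finrank_zero_of_subsingleton
    have := Module.finrank_zero_iff.1 h0
    have : Subsingleton B := ⟨fun x y => by
      rw [← LinearMap.id_apply (R := R) x, Subsingleton.elim (LinearMap.id : B →ₗ[R] B) 0,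
        ← LinearMap.id_apply (R := R) y, Subsingleton.elim (LinearMap.id : B →ₗ[R] B) 0]
      rfl⟩
    exact ⟨0⟩
  have hsub : ∀ {C : Type u} [AddCommGroup C] [Module k C] [Module R C] [IsScalarTower k R C]
      [Module.Finite k C] (U : Submodule R C), Module.finrank k C ≤ N →
        Module.Finite k U ∧ Module.finrank k U ≤ N := fun U hC =>
    ⟨inferInstanceAs (Module.Finite k (U.restrictScalars k)),
      (Submodule.finrank_le (U.restrictScalars k)).trans hC⟩
  have htA : (⨆ g : B →ₗ[R] A, LinearMap.range g) = ⊤ := by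
    obtain ⟨_, hle⟩ := hsub (⨆ g : B →ₗ[R] A, LinearMap.range g) hAN
    exact iSup_range_eq_top_of_finrank_hom_eq_s4 (h A hAN) (h _ hle)
  have htB : (⨆ f : A →ₗ[R] B, LinearMap.range f) = ⊤ := by
    obtain ⟨_, hle⟩ := hsub (⨆ f : A →ₗ[R] B, LinearMap.range f) hBN
    exact iSup_range_eq_top_of_finrank_hom_eq_s4 (h B hBN).symm (h _ hle).symm
  obtain ⟨M, hM, ⟨r, hr⟩, j, s, hs⟩ := exists_common_summand_s4 (k := k) htA htB
  let eA := prodKerEquivOfLeftInverse M.subtype r hr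
  let eB := prodKerEquivOfLeftInverse j s hs
  obtain ⟨_, -⟩ := hsub M hAN
  obtain ⟨_, hkr⟩ := hsub (LinearMap.ker r) hAN
  obtain ⟨_, hks⟩ := hsub (LinearMap.ker s) hBN
  have hlt : Module.finrank k (LinearMap.ker r) < Module.finrank k A := by
    rw [← (eA.restrictScalars k).finrank_eq, Module.finrank_prod]
    have : Nontrivial M := Submodule.nontrivial_iff_ne_bot.2 hM
    have : 0 < Module.finrank k M := Module.finrank_pos
    omega
  obtain ⟨e⟩ := ih _ hlt (LinearMap.ker r) (LinearMap.ker s) hkr hks (fun Y _ _ _ _ _ hY => by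
    have hY' := h Y hY
    rw [← (eA.congrLeft Y k).finrank_eq, ← (eB.congrLeft Y k).finrank_eq, finrank_hom_prod,
      finrank_hom_prod] at hY'
    omega) rfl
  exact ⟨eA.symm ≪≫ₗ ((LinearEquiv.refl R M).prodCongr e) ≪≫ₗ eB⟩

end HomDimension

section TupleModule

variable {k : Type*} [Field k] {p : ℕ}

/-- The module over the free algebra on which the generators act by the endomorphisms `T i`. -/
def TupleModule {V : Type*} [AddCommGroup V] [Module k V] (_ : Fin p → Module.End k V) : Type _ :=
  V

namespace TupleModule

variable {V : Type*} [AddCommGroup V] [Module k V] (T : Fin p → Module.End k V)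

instance : AddCommGroup (TupleModule T) := inferInstanceAs (AddCommGroup V)

instance : Module k (TupleModule T) := inferInstanceAs (Module k V)

instance [Module.Finite k V] : Module.Finite k (TupleModule T) :=
  inferInstanceAs (Module.Finite k V)

instance : Module (FreeAlgebra k (Fin p)) (TupleModule T) :=
  Module.compHom V (FreeAlgebra.lift k T : FreeAlgebra k (Fin p) →ₐ[k] Module.End k V).toRingHom

theorem smul_def (c : FreeAlgebra k (Fin p)) (x : TupleModule T) :
    c • x = (FreeAlgebra.lift k T c : Module.End k V) x := rfl

/-- A tuple module is its underlying vector space. -/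
def equiv : TupleModule T ≃ₗ[k] V := LinearEquiv.refl k V

theorem equiv_ι_smul (i : Fin p) (x : TupleModule T) :
    equiv T (FreeAlgebra.ι k i • x) = T i (equiv T x) := by
  rw [smul_def, FreeAlgebra.lift_ι_apply]
  rfl

theorem equiv_symm_apply (i : Fin p) (v : V) :
    (equiv T).symm (T i v) = FreeAlgebra.ι k i • (equiv T).symm v := by
  rw [LinearEquiv.symm_apply_eq, equiv_ι_smul, LinearEquiv.apply_symm_apply]

instance : IsScalarTower k (FreeAlgebra k (Fin p)) (TupleModule T) where
  smul_assoc c a x := by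
    rw [smul_def, smul_def, map_smul]
    rfl

end TupleModule

/-- A linear map commuting with the generators is linear over the free algebra. -/
def FreeAlgebra.linearMapOfCommute {X V W : Type*}
    [AddCommGroup V] [Module k V] [Module (FreeAlgebra k X) V] [IsScalarTower k (FreeAlgebra k X) V]
    [AddCommGroup W] [Module k W] [Module (FreeAlgebra k X) W] [IsScalarTower k (FreeAlgebra k X) W]
    (f : V →ₗ[k] W) (hf : ∀ (i : X) (x : V), f (FreeAlgebra.ι k i • x) = FreeAlgebra.ι k i • f x) :
    V →ₗ[FreeAlgebra k X] W where
  toFun := f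
  map_add' := map_add f
  map_smul' a := by
    induction a with
    | grade0 r => intro x; simp
    | grade1 i => exact hf i
    | mul a b ha hb =>
      intro x
      simp only [RingHom.id_apply] at ha hb ⊢
      rw [mul_smul, ha, hb, mul_smul]
    | add a b ha hb =>
      intro x
      simp only [RingHom.id_apply] at ha hb ⊢
      rw [add_smul, map_add, ha, hb, add_smul]

variable {n : ℕ}

/-- The module over the free algebra attached to a tuple of matrices. -/
abbrev MatrixTupleModule (A : Fin p → Matrix (Fin n) (Fin n) k) : Type _ :=
  TupleModule fun i => Matrix.toLin' (A i)

/-- The matrices by which the generators act on a module with chosen coordinates. -/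
def actionMatrix {Y : Type*} [AddCommGroup Y] [Module k Y] [Module (FreeAlgebra k (Fin p)) Y]
    [IsScalarTower k (FreeAlgebra k (Fin p)) Y] (e : Y ≃ₗ[k] (Fin n → k)) (i : Fin p) :
    Matrix (Fin n) (Fin n) k :=
  LinearMap.toMatrix' (e.conj (Algebra.lsmul k k Y (FreeAlgebra.ι k i)))

theorem actionMatrix_mulVec {Y : Type*} [AddCommGroup Y] [Module k Y]
    [Module (FreeAlgebra k (Fin p)) Y] [IsScalarTower k (FreeAlgebra k (Fin p)) Y]
    (e : Y ≃ₗ[k] (Fin n → k)) (i : Fin p) (v : Fin n → k) :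
    actionMatrix e i *ᵥ v = e (FreeAlgebra.ι k i • e.symm v) := by
  rw [actionMatrix, ← Matrix.toLin'_apply, Matrix.toLin'_toMatrix']
  rfl

/-- Module homomorphisms out of a tuple of matrices are the intertwiners. -/
def homEquivIntertwinerSpace {Y : Type*} [AddCommGroup Y] [Module k Y]
    [Module (FreeAlgebra k (Fin p)) Y] [IsScalarTower k (FreeAlgebra k (Fin p)) Y]
    (A : Fin p → Matrix (Fin n) (Fin n) k) (e : Y ≃ₗ[k] (Fin n → k)) :
    (MatrixTupleModule A →ₗ[FreeAlgebra k (Fin p)] Y) ≃ₗ[k]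
      intertwinerSpace A (actionMatrix e) where
  toFun f := ⟨LinearMap.toMatrix'
      (e.toLinearMap ∘ₗ f.restrictScalars k ∘ₗ (TupleModule.equiv _).symm.toLinearMap),
    fun i => by
      apply Matrix.toLin'.injective
      apply LinearMap.ext
      intro v
      simp only [Matrix.toLin'_mul, Matrix.toLin'_toMatrix', LinearMap.comp_apply,
        Matrix.toLin'_apply (actionMatrix e i), actionMatrix_mulVec, LinearEquiv.coe_coe,
        TupleModule.equiv_symm_apply, LinearMap.coe_restrictScalars, map_smul,
        LinearEquiv.symm_apply_apply]⟩
  map_add' f g := by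
    apply Subtype.ext
    apply Matrix.toLin'.injective
    apply LinearMap.ext
    intro v
    simp
  map_smul' c f := by
    apply Subtype.ext
    apply Matrix.toLin'.injective
    apply LinearMap.ext
    intro v
    simp
  invFun Z := FreeAlgebra.linearMapOfCommute
    (e.symm.toLinearMap ∘ₗ Matrix.toLin' Z.1 ∘ₗ (TupleModule.equiv _).toLinearMap) fun i x => by
      apply e.injective
      have := congrArg (fun M => M *ᵥ TupleModule.equiv _ x) (Z.2 i)
      simp only [← Matrix.mulVec_mulVec, actionMatrix_mulVec] at this
      simpa [TupleModule.equiv_ι_smul] using this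
  left_inv f := by
    apply LinearMap.ext
    intro v
    simp [FreeAlgebra.linearMapOfCommute]
  right_inv Z := by
    apply Subtype.ext
    apply Matrix.toLin'.injective
    apply LinearMap.ext
    intro v
    simp [FreeAlgebra.linearMapOfCommute]

/-- Equality of the dimensions of all intertwiner spaces makes the attached modules isomorphic. -/
theorem nonempty_linearEquiv_of_finrank_intertwinerSpace_eq
    (A B : Fin p → Matrix (Fin n) (Fin n) k)
    (h : ∀ Y : Fin p → Matrix (Fin n) (Fin n) k,
      Module.finrank k (intertwinerSpace A Y) = Module.finrank k (intertwinerSpace B Y)) :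
    Nonempty (MatrixTupleModule A ≃ₗ[FreeAlgebra k (Fin p)] MatrixTupleModule B) := by
  have hdim : ∀ C : Fin p → Matrix (Fin n) (Fin n) k,
      Module.finrank k (MatrixTupleModule C) = n := fun C =>
    Module.finrank_fin_fun (n := n) k
  rcases Nat.eq_zero_or_pos n with rfl | hn
  · have hs : ∀ C : Fin p → Matrix (Fin 0) (Fin 0) k, Subsingleton (MatrixTupleModule C) :=
      fun _ => inferInstanceAs (Subsingleton (Fin 0 → k))
    have := hs A
    have := hs B
    exact ⟨0⟩
  have heq : ∀ (Y : Type _) [AddCommGroup Y] [Module k Y] [Module (FreeAlgebra k (Fin p)) Y]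
      [IsScalarTower k (FreeAlgebra k (Fin p)) Y] [Module.Finite k Y], Module.finrank k Y = n →
      Module.finrank k (MatrixTupleModule A →ₗ[FreeAlgebra k (Fin p)] Y) =
        Module.finrank k (MatrixTupleModule B →ₗ[FreeAlgebra k (Fin p)] Y) := by
    intro Y _ _ _ _ _ hY
    let e : Y ≃ₗ[k] (Fin n → k) := LinearEquiv.ofFinrankEq _ _ (by simp [hY])
    rw [(homEquivIntertwinerSpace A e).finrank_eq, (homEquivIntertwinerSpace B e).finrank_eq]
    exact h _
  let S := TupleModule (k := k) (p := p) (V := k) 0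
  have hS1 : Module.finrank k S = 1 := Module.finrank_self k
  have hS := heq (Fin n → S) (by simp [Module.finrank_pi_fintype, hS1])
  rw [finrank_hom_pi, finrank_hom_pi] at hS
  have hS' := Nat.eq_of_mul_eq_mul_left hn hS
  refine nonempty_linearEquiv_of_finrank_hom_eq_s4 (k := k) n _ _ (hdim A).le (hdim B).le ?_
  intro Y _ _ _ _ _ hY
  have := heq (Y × (Fin (n - Module.finrank k Y) → S))
    (by simp [Module.finrank_prod, Module.finrank_pi_fintype, hS1, hY])
  rw [finrank_hom_prod_right, finrank_hom_prod_right, finrank_hom_pi, finrank_hom_pi, hS'] at this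
  exact Nat.add_right_cancel this

theorem exists_conj_of_linearEquiv (A B : Fin p → Matrix (Fin n) (Fin n) k)
    (e : MatrixTupleModule A ≃ₗ[FreeAlgebra k (Fin p)] MatrixTupleModule B) :
    ∃ S : GL (Fin n) k, ∀ i, B i = S.val * A i * S⁻¹.val := by
  let f : (Fin n → k) ≃ₗ[k] (Fin n → k) :=
    (TupleModule.equiv _).symm ≪≫ₗ e.restrictScalars k ≪≫ₗ TupleModule.equiv _
  let S : GL (Fin n) k :=
    ⟨LinearMap.toMatrix' f.toLinearMap, LinearMap.toMatrix' f.symm.toLinearMap,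
      by rw [← LinearMap.toMatrix'_comp]; simp, by rw [← LinearMap.toMatrix'_comp]; simp⟩
  refine ⟨S, fun i => ?_⟩
  have key : S.val * A i = B i * S.val := by
    apply Matrix.toLin'.injective
    apply LinearMap.ext
    intro v
    have hv : f (Matrix.toLin' (A i) v) = Matrix.toLin' (B i) (f v) := by
      simp only [f, LinearEquiv.trans_apply, TupleModule.equiv_symm_apply,
        LinearEquiv.restrictScalars_apply, map_smul, TupleModule.equiv_ι_smul]
    simpa only [S, Matrix.toLin'_mul, Matrix.toLin'_toMatrix', LinearMap.comp_apply,
      LinearEquiv.coe_coe] using hv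
  rw [key, mul_assoc, ← Units.val_mul, mul_inv_cancel, Units.val_one, mul_one]

theorem finrank_intertwinerSpace_le_of_conj {A B : Fin p → Matrix (Fin n) (Fin n) k}
    (S : GL (Fin n) k) (hS : ∀ i, B i = S.val * A i * S⁻¹.val)
    (Y : Fin p → Matrix (Fin n) (Fin n) k) :
    Module.finrank k (intertwinerSpace A Y) ≤ Module.finrank k (intertwinerSpace B Y) := by
  let φ : intertwinerSpace A Y →ₗ[k] intertwinerSpace B Y :=
    { toFun := fun Z => ⟨Z.1 * S⁻¹.val, fun i => by
        have hZ : Z.1 * A i = Y i * Z.1 := Z.2 i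
        rw [hS, ← mul_assoc (Y i), ← hZ]
        simp only [mul_assoc]
        rw [← mul_assoc S⁻¹.val S.val, ← Units.val_mul, inv_mul_cancel, Units.val_one, one_mul]⟩
      map_add' := fun _ _ => Subtype.ext (add_mul _ _ _)
      map_smul' := fun _ _ => Subtype.ext (smul_mul_assoc _ _ _) }
  refine LinearMap.finrank_le_finrank_of_injective (f := φ) fun Z W hZW => Subtype.ext ?_
  exact (Units.mul_left_inj S⁻¹).1 (congrArg Subtype.val hZW)

end TupleModule

/-- Two `p`-tuples of `n×n` matrices are simultaneously similar iff
for every tuple `Y`, the dimensions of the intertwiner spaces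
`{Z : Z A_i = Y_i Z}` and `{Z : Z B_i = Y_i Z}` coincide. -/
theorem stmt4 {k : Type*} [Field k] {n p : ℕ}
    (A B : Fin p → Matrix (Fin n) (Fin n) k) :
    (∃ S : GL (Fin n) k, ∀ i, B i = S.val * A i * S⁻¹.val) ↔
      ∀ Y : Fin p → Matrix (Fin n) (Fin n) k,
        Module.finrank k (intertwinerSpace A Y) =
          Module.finrank k (intertwinerSpace B Y) := by
  constructor
  · rintro ⟨S, hS⟩ Y
    refine le_antisymm (finrank_intertwinerSpace_le_of_conj S hS Y)
      (finrank_intertwinerSpace_le_of_conj S⁻¹ (fun i => ?_) Y)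
    rw [hS, inv_inv]
    simp only [mul_assoc, Units.inv_mul, mul_one]
    rw [← mul_assoc, Units.inv_mul, one_mul]
  · intro h
    obtain ⟨e⟩ := nonempty_linearEquiv_of_finrank_intertwinerSpace_eq A B h
    exact exists_conj_of_linearEquiv A B e
end

section
/- Let k be a field and A = (A_1, …, A_p), B = (B_1, …, B_p) two p-tuples of n×n matrices over k. Let R = k[y_{st,l} : s, t ∈ [n], l ∈ [p]] and Y = (Y_1, …, Y_p) the tuple of generic matrices Y_l = (y_{st,l}). Then A and B are simultaneously similar if and only if for every r ∈ [n²], the k-subspace of R spanned by all r×r minors of L(A, Y) equals the k-subspace of R spanned by all r×r minors of L(B, Y). -/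
open Matrix Kronecker

/-- The `(pn²)×n²` matrix `L(A, Y)` over a commutative `k`-algebra `R`, whose `l`-th
`n²×n²` block is `A_lᵀ ⊗ I_n − I_n ⊗ Y_l`. -/
def LMat {k R : Type*} [Field k] [CommRing R] [Algebra k R] {n p : ℕ}
    (A : Fin p → Matrix (Fin n) (Fin n) k)
    (Y : Fin p → Matrix (Fin n) (Fin n) R) :
    Matrix (Fin p × Fin n × Fin n) (Fin n × Fin n) R :=
  Matrix.of fun li j =>
    ((((A li.1).map (algebraMap k R))ᵀ ⊗ₖ (1 : Matrix (Fin n) (Fin n) R)) -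
      ((1 : Matrix (Fin n) (Fin n) R) ⊗ₖ Y li.1)) li.2 j

/-- The tuple `Y = (Y_1, …, Y_p)` of generic `n×n` matrices
`Y_l = (y_{st,l})` over the polynomial ring `R = k[y_{st,l}]` in `pn²` variables. -/
noncomputable def genericY (k : Type*) [Field k] (n p : ℕ) :
    Fin p → Matrix (Fin n) (Fin n) (MvPolynomial (Fin n × Fin n × Fin p) k) :=
  fun l => Matrix.of fun s t => MvPolynomial.X (s, t, l)

/-- The `k`-subspace of `R = k[y_{st,l}]` spanned by all `r×r` minors of `L(A, Y)`,
`Y` the tuple of generic matrices. -/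
noncomputable def minorSpan {k : Type*} [Field k] {n p : ℕ}
    (A : Fin p → Matrix (Fin n) (Fin n) k) (r : ℕ) :
    Submodule k (MvPolynomial (Fin n × Fin n × Fin p) k) :=
  Submodule.span k
    {f | ∃ α : Fin r → Fin p × Fin n × Fin n, ∃ β : Fin r → Fin n × Fin n,
      Function.Injective α ∧ Function.Injective β ∧
      f = ((LMat A (genericY k n p)).submatrix α β).det}

namespace SimultaneousSimilarity

section HomSpaces

universe u

open LinearMap Module

variable {k F : Type*} [Field k] [Ring F] [Algebra k F]
  {M N C : Type*} [AddCommGroup M] [AddCommGroup N] [AddCommGroup C]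
  [Module k M] [Module k N] [Module k C] [Module F M] [Module F N] [Module F C]
  [IsScalarTower k F M] [IsScalarTower k F N] [IsScalarTower k F C]

/-- Restriction of scalars as a `k`-linear map on spaces of `F`-linear maps. -/
def homRestrict (k F M C : Type*) [Field k] [Ring F] [Algebra k F]
    [AddCommGroup M] [AddCommGroup C] [Module k M] [Module k C] [Module F M] [Module F C]
    [IsScalarTower k F M] [IsScalarTower k F C] :
    (M →ₗ[F] C) →ₗ[k] (M →ₗ[k] C) where
  toFun f := f.restrictScalars k
  map_add' _ _ := rfl
  map_smul' _ _ := rfl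

theorem homRestrict_injective : Function.Injective (homRestrict k F M C) :=
  LinearMap.restrictScalars_injective k

theorem finite_hom [Module.Finite k M] [Module.Finite k C] : Module.Finite k (M →ₗ[F] C) :=
  Module.Finite.of_injective (homRestrict k F M C) homRestrict_injective

/-- Postcomposition with an `F`-linear map, as a `k`-linear map. -/
def postcomp (k : Type*) {F : Type*} [Field k] [Ring F] [Algebra k F] (M : Type*)
    [AddCommGroup M] [Module F M] {N C : Type*} [AddCommGroup N] [AddCommGroup C]
    [Module k N] [Module k C] [Module F N] [Module F C]
    [IsScalarTower k F N] [IsScalarTower k F C] (g : N →ₗ[F] C) :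
    (M →ₗ[F] N) →ₗ[k] (M →ₗ[F] C) where
  toFun f := g.comp f
  map_add' _ _ := LinearMap.comp_add _ _ _
  map_smul' c f := by
    ext x
    exact g.map_smul_of_tower c (f x)

theorem postcomp_injective (k : Type*) {F : Type*} [Field k] [Ring F] [Algebra k F] (M : Type*)
    [AddCommGroup M] [Module F M] {N C : Type*} [AddCommGroup N] [AddCommGroup C]
    [Module k N] [Module k C] [Module F N] [Module F C]
    [IsScalarTower k F N] [IsScalarTower k F C] {g : N →ₗ[F] C} (hg : Function.Injective g) :
    Function.Injective (postcomp k M g) := fun _ _ h =>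
  LinearMap.ext fun x => hg congr(($h : M →ₗ[F] C) x)

theorem finrank_hom_congr (k : Type*) {F : Type*} [Field k] [Ring F] [Algebra k F]
    {M N C : Type*} [AddCommGroup M] [AddCommGroup N] [AddCommGroup C] [Module k C]
    [Module F M] [Module F N] [Module F C] [IsScalarTower k F C] (e : M ≃ₗ[F] N) :
    finrank k (M →ₗ[F] C) = finrank k (N →ₗ[F] C) :=
  (LinearEquiv.congrLeft C k e).finrank_eq

theorem finrank_hom_prod [Module.Finite k M] [Module.Finite k N] [Module.Finite k C] :
    finrank k (M × N →ₗ[F] C) = finrank k (M →ₗ[F] C) + finrank k (N →ₗ[F] C) := by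
  have : Module.Finite k (M →ₗ[F] C) := finite_hom
  have : Module.Finite k (N →ₗ[F] C) := finite_hom
  rw [← (LinearMap.coprodEquiv (R := F) (M := M) (M₂ := N) (M₃ := C) k).finrank_eq,
    finrank_prod]

/-- If the trace of `M` in `N` and `N` itself cannot tell `M` from `N` by the dimensions of
their homomorphism spaces, then `M` generates `N`. -/
theorem iSup_range_eq_top [Module.Finite k M] [Module.Finite k N]
    (hT : finrank k (M →ₗ[F] ↥(⨆ f : M →ₗ[F] N, range f)) =
      finrank k (N →ₗ[F] ↥(⨆ f : M →ₗ[F] N, range f)))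
    (hN : finrank k (M →ₗ[F] N) = finrank k (N →ₗ[F] N)) :
    ⨆ f : M →ₗ[F] N, range f = ⊤ := by
  set T : Submodule F N := ⨆ f : M →ₗ[F] N, range f
  have : Module.Finite k T :=
    inferInstanceAs (Module.Finite k (T.restrictScalars k))
  have : Module.Finite k (M →ₗ[F] T) := finite_hom
  have : Module.Finite k (N →ₗ[F] T) := finite_hom
  have : Module.Finite k (M →ₗ[F] N) := finite_hom
  have : Module.Finite k (N →ₗ[F] N) := finite_hom
  have hsurj : Function.Surjective (postcomp k M T.subtype) := fun f =>
    ⟨f.codRestrict T fun x => le_iSup (fun f : M →ₗ[F] N => range f) f ⟨x, rfl⟩,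
      LinearMap.ext fun _ => rfl⟩
  have hMT : finrank k (M →ₗ[F] T) = finrank k (M →ₗ[F] N) :=
    (LinearEquiv.ofBijective _ ⟨postcomp_injective k M T.injective_subtype, hsurj⟩).finrank_eq
  obtain ⟨g, hg⟩ := (LinearMap.injective_iff_surjective_of_finrank_eq_finrank
    (by rw [← hT, hMT, hN])).1 (postcomp_injective k N T.injective_subtype) LinearMap.id
  refine eq_top_iff.2 fun x _ => ?_
  have : (g x : N) = x := congr($hg x)
  exact this ▸ (g x).2

/-- If `M` and `N` generate each other, some composite `N → M → N` is not nilpotent. -/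
theorem exists_not_isNilpotent (k : Type*) {F : Type*} [Field k] [Ring F] [Algebra k F]
    {M N : Type*} [AddCommGroup M] [AddCommGroup N] [Module k N] [Module F M] [Module F N]
    [IsScalarTower k F N] [Module.Finite k N] [Nontrivial N]
    (hN : ⨆ f : M →ₗ[F] N, range f = ⊤) (hM : ⨆ f : N →ₗ[F] M, range f = ⊤) :
    ∃ (f : M →ₗ[F] N) (g : N →ₗ[F] M), ¬ IsNilpotent (f ∘ₗ g : Module.End F N) := by
  by_contra! h
  have hrad (f : M →ₗ[F] N) (g : N →ₗ[F] M) :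
      (f ∘ₗ g : Module.End F N) ∈ Ring.jacobson (Module.End F N) := by
    rw [← Ideal.jacobson_bot, Ideal.mem_jacobson_iff]
    intro y
    obtain ⟨u, hu⟩ := (h (y ∘ₗ f) g).isUnit_add_one
    refine ⟨↑u⁻¹, ?_⟩
    have : (y * (f ∘ₗ g) : Module.End F N) + 1 = u := hu.symm
    have h2 : (↑u⁻¹ : Module.End F N) * (y * (f ∘ₗ g) + 1) = 1 := by rw [this, u.inv_mul]
    rw [Ideal.mem_bot, mul_assoc, ← h2, mul_add, mul_one, sub_self]
  have : Module.Finite (Module.End F N) N := Module.Finite.of_restrictScalars_finite k _ _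
  have hJ : ∀ x : N, x ∈ Ring.jacobson (Module.End F N) • (⊤ : Submodule (Module.End F N) N) := by
    intro x
    have hx : x ∈ ⨆ f : M →ₗ[F] N, range f := hN ▸ Submodule.mem_top
    induction hx using Submodule.iSup_induction' with
    | zero => exact zero_mem _
    | add _ _ _ _ h₁ h₂ => exact add_mem h₁ h₂
    | mem f _ hx =>
      obtain ⟨y, rfl⟩ := hx
      have hy : y ∈ ⨆ g : N →ₗ[F] M, range g := hM ▸ Submodule.mem_top
      induction hy using Submodule.iSup_induction' with
      | zero => rw [map_zero]; exact zero_mem _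
      | add _ _ _ _ h₁ h₂ => rw [map_add]; exact add_mem h₁ h₂
      | mem g _ hy =>
        obtain ⟨z, rfl⟩ := hy
        exact Submodule.smul_mem_smul (hrad f g) (Submodule.mem_top (x := z))
  have := Submodule.FG.eq_bot_of_le_jacobson_smul (Module.Finite.fg_top (R := Module.End F N)
    (M := N)) fun x _ => hJ x
  exact bot_ne_top this.symm

/-- Fitting decomposition: a non-nilpotent composite `N → M → N` splits off isomorphic
direct summands of `M` and `N`. -/
theorem exists_common_summand [Module.Finite k M] [Module.Finite k N]
    (f : M →ₗ[F] N) (g : N →ₗ[F] M) (h : ¬ IsNilpotent (f ∘ₗ g : Module.End F N)) :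
    ∃ (M' P' : Submodule F M) (N' P : Submodule F N), IsCompl M' P' ∧ IsCompl N' P ∧ P ≠ ⊥ ∧
      Nonempty (P' ≃ₗ[F] P) := by
  have : IsArtinian F M := isArtinian_of_tower k inferInstance
  have : IsArtinian F N := isArtinian_of_tower k inferInstance
  have : IsNoetherian F M := isNoetherian_of_tower k inferInstance
  have : IsNoetherian F N := isNoetherian_of_tower k inferInstance
  set a : Module.End F N := f ∘ₗ g
  set b : Module.End F M := g ∘ₗ f
  obtain ⟨n, hn, ha, hb⟩ := ((Filter.eventually_ge_atTop 1).and
    (a.eventually_isCompl_ker_pow_range_pow.and b.eventually_isCompl_ker_pow_range_pow)).exists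
  have hga (m : ℕ) (x : N) : g ((a ^ m) x) = (b ^ m) (g x) := by
    induction m generalizing x with
    | zero => rfl
    | succ m ih => rw [pow_succ, pow_succ]; exact ih (a x)
  have hfb (m : ℕ) (x : M) : f ((b ^ m) x) = (a ^ m) (f x) := by
    induction m generalizing x with
    | zero => rfl
    | succ m ih => rw [pow_succ, pow_succ]; exact ih (b x)
  have hker (x : N) (hx : x ∈ range (a ^ n)) (h0 : g x = 0) : x = 0 := by
    refine Submodule.disjoint_def.1 ha.disjoint x ?_ hx
    obtain ⟨m, rfl⟩ := Nat.exists_eq_add_of_le' hn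
    rw [mem_ker, pow_succ, Module.End.mul_apply, show a x = f (g x) from rfl, h0, map_zero,
      map_zero]
  have hker' (x : M) (hx : x ∈ range (b ^ n)) (h0 : f x = 0) : x = 0 := by
    refine Submodule.disjoint_def.1 hb.disjoint x ?_ hx
    obtain ⟨m, rfl⟩ := Nat.exists_eq_add_of_le' hn
    rw [mem_ker, pow_succ, Module.End.mul_apply, show b x = g (f x) from rfl, h0, map_zero,
      map_zero]
  let φ : range (b ^ n) →ₗ[F] range (a ^ n) := f.restrict (by
    rintro _ ⟨x, rfl⟩
    exact ⟨f x, (hfb n x).symm⟩)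
  let ψ : range (a ^ n) →ₗ[F] range (b ^ n) := g.restrict (by
    rintro _ ⟨x, rfl⟩
    exact ⟨g x, (hga n x).symm⟩)
  have hφ : Function.Injective φ := (injective_iff_map_eq_zero φ).2 fun x hx =>
    Subtype.ext (hker' x x.2 congr(($hx : N)))
  have hψ : Function.Injective ψ := (injective_iff_map_eq_zero ψ).2 fun x hx =>
    Subtype.ext (hker x x.2 congr(($hx : M)))
  have : Module.Finite k (range (a ^ n)) :=
    inferInstanceAs (Module.Finite k ((range (a ^ n)).restrictScalars k))
  have : Module.Finite k (range (b ^ n)) :=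
    inferInstanceAs (Module.Finite k ((range (b ^ n)).restrictScalars k))
  have hdim : finrank k (range (b ^ n)) = finrank k (range (a ^ n)) :=
    le_antisymm (LinearMap.finrank_le_finrank_of_injective (f := φ.restrictScalars k) hφ)
      (LinearMap.finrank_le_finrank_of_injective (f := ψ.restrictScalars k) hψ)
  have hsurj : Function.Surjective φ :=
    (LinearMap.injective_iff_surjective_of_finrank_eq_finrank (f := φ.restrictScalars k) hdim).1 hφ
  refine ⟨_, _, _, _, hb, ha, fun h0 => h ⟨n, range_eq_bot.1 h0⟩, ⟨.ofBijective φ ⟨hφ, hsurj⟩⟩⟩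

/-- Finite-dimensional modules are determined by the dimensions of their homomorphism spaces
into modules of bounded dimension. -/
theorem nonempty_linearEquiv_of_finrank_hom_eq (k F : Type*) [Field k] [Ring F] [Algebra k F]
    (d m : ℕ) (M N : Type u) [AddCommGroup M] [AddCommGroup N]
    [Module k M] [Module k N] [Module F M] [Module F N]
    [IsScalarTower k F M] [IsScalarTower k F N] [Module.Finite k M] [Module.Finite k N]
    (hMd : finrank k M ≤ d) (hNd : finrank k N ≤ d) (hm : finrank k N = m)
    (h : ∀ (C : Type u) [AddCommGroup C] [Module k C] [Module F C] [IsScalarTower k F C]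
      [Module.Finite k C], finrank k C ≤ d →
      finrank k (M →ₗ[F] C) = finrank k (N →ₗ[F] C)) :
    Nonempty (M ≃ₗ[F] N) := by
  induction m using Nat.strong_induction_on generalizing M N with
  | _ m ih =>
  rcases subsingleton_or_nontrivial N with hN | hN
  · have : Module.Finite k (M →ₗ[F] M) := finite_hom
    have h0 : finrank k (M →ₗ[F] M) = 0 := by
      rw [h M hMd]
      exact finrank_zero_of_subsingleton
    have := finrank_zero_iff.1 h0
    have : Subsingleton M := ⟨fun x y => by
      have hid (x : M) : x = 0 := congr($(Subsingleton.elim (LinearMap.id : M →ₗ[F] M) 0) x)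
      rw [hid x, hid y]⟩
    exact ⟨0⟩
  · have hsub {L : Type u} [AddCommGroup L] [Module k L] [Module F L] [IsScalarTower k F L]
        [Module.Finite k L] (T : Submodule F L) :
        Module.Finite k T ∧ finrank k T ≤ finrank k L :=
      ⟨inferInstanceAs (Module.Finite k (T.restrictScalars k)),
        Submodule.finrank_le (T.restrictScalars k)⟩
    have hfin {L : Type u} [AddCommGroup L] [Module k L] [Module F L] [IsScalarTower k F L]
        [Module.Finite k L] (T : Submodule F L) : Module.Finite k T := (hsub T).1
    have htN : ⨆ f : M →ₗ[F] N, range f = ⊤ :=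
      iSup_range_eq_top (k := k) (h _ ((hsub _).2.trans hNd)) (h _ hNd)
    have htM : ⨆ f : N →ₗ[F] M, range f = ⊤ :=
      iSup_range_eq_top (k := k) (h _ ((hsub _).2.trans hMd)).symm (h _ hMd).symm
    obtain ⟨f, g, hfg⟩ := exists_not_isNilpotent k htN htM
    obtain ⟨M', P', N', P, hM, hN, hP, ⟨e⟩⟩ := exists_common_summand (k := k) f g hfg
    have eM := Submodule.prodEquivOfIsCompl M' P' hM
    have eN := Submodule.prodEquivOfIsCompl N' P hN
    have hlt : finrank k N' < m := by
      have h1 : finrank k N' + finrank k P = finrank k N := by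
        rw [← finrank_prod, (eN.restrictScalars k).finrank_eq]
      have : Nontrivial P := (Submodule.nontrivial_iff_ne_bot).2 hP
      have h2 : 0 < finrank k P := finrank_pos
      omega
    obtain ⟨e'⟩ := ih _ hlt M' N' ((hsub _).2.trans hMd) ((hsub _).2.trans hNd) rfl
      fun C _ _ _ _ _ hC => by
        have := h C hC
        rw [← finrank_hom_congr k eM, ← finrank_hom_congr k eN, finrank_hom_prod,
          finrank_hom_prod, finrank_hom_congr k e] at this
        exact Nat.add_right_cancel this
    exact ⟨eM.symm ≪≫ₗ e'.prodCongr e ≪≫ₗ eN⟩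

end HomSpaces

section Rank

open Module

variable {K : Type*} [Field K] {m n : Type*} [Finite m] [Fintype n]

theorem exists_linearIndependent_rows (M : Matrix m n K) :
    ∃ α : Fin M.rank → m, Function.Injective α ∧ LinearIndependent K fun i => M (α i) := by
  obtain ⟨κ, a, ha, hsp, hli⟩ := exists_linearIndependent' K M.row
  have : Finite κ := Finite.of_injective a ha
  have := Fintype.ofFinite κ
  have hcard : Fintype.card κ = M.rank := by
    rw [M.rank_eq_finrank_span_row, ← hsp, finrank_span_eq_card hli]
  let e : Fin M.rank ≃ κ := (Fintype.equivFinOfCardEq hcard).symm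
  exact ⟨a ∘ e, ha.comp e.injective, hli.comp e e.injective⟩

theorem exists_det_submatrix_ne_zero (M : Matrix m n K) :
    ∃ (α : Fin M.rank → m) (β : Fin M.rank → n), Function.Injective α ∧ Function.Injective β ∧
      (M.submatrix α β).det ≠ 0 := by
  obtain ⟨α, hα, hli⟩ := exists_linearIndependent_rows M
  have hrank : (M.submatrix α id)ᵀ.rank = M.rank := by
    rw [rank_transpose, LinearIndependent.rank_matrix (M := M.submatrix α id) hli,
      Fintype.card_fin]
  obtain ⟨β, hβ, hli'⟩ := exists_linearIndependent_rows (M.submatrix α id)ᵀ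
  refine ⟨α, β ∘ finCongr hrank.symm, hα, hβ.comp (finCongr hrank.symm).injective, ?_⟩
  have := hli'.comp _ (finCongr hrank.symm).injective
  rw [← det_transpose, ← isUnit_iff_ne_zero, ← isUnit_iff_isUnit_det,
    ← linearIndependent_rows_iff_isUnit]
  exact this

theorem le_rank_of_det_submatrix_ne_zero {K m n : Type*} [Field K] [Fintype n] {r : ℕ}
    (M : Matrix m n K) (α : Fin r → m) (β : Fin r → n) (h : (M.submatrix α β).det ≠ 0) : r ≤ M.rank :=
  calc r = (M.submatrix α β).rank := by rw [rank_of_det_ne_zero h, Fintype.card_fin]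
    _ ≤ M.rank := rank_submatrix_le _ _ _

theorem rank_map_algebraMap {k : Type*} [Field k] [Algebra k K] (M : Matrix m n k) :
    (M.map (algebraMap k K)).rank = M.rank := by
  have key {r : ℕ} (α : Fin r → m) (β : Fin r → n) :
      ((M.map (algebraMap k K)).submatrix α β).det =
        algebraMap k K (M.submatrix α β).det := by
    rw [RingHom.map_det]
    rfl
  apply le_antisymm
  · obtain ⟨α, β, -, -, h⟩ := exists_det_submatrix_ne_zero (M.map (algebraMap k K))
    rw [key] at h
    exact le_rank_of_det_submatrix_ne_zero M α β fun h0 => h (by rw [h0, map_zero])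
  · obtain ⟨α, β, -, -, h⟩ := exists_det_submatrix_ne_zero M
    refine le_rank_of_det_submatrix_ne_zero _ α β ?_
    rw [key]
    exact fun h0 => h ((map_eq_zero _).1 h0)

end Rank

section Intertwiners

open Module

variable {K : Type*} [Field K] {p : ℕ} {n ι κ : Type*} [Fintype n] [Fintype ι] [Fintype κ]

/-- The space of matrices `X` with `X A_l = D_l X` for all `l`. -/
def intertwiners (A : Fin p → Matrix n n K) (D : Fin p → Matrix ι ι K) :
    Submodule K (Matrix ι n K) where
  carrier := {X | ∀ l, X * A l = D l * X}
  add_mem' hX hY l := by rw [Matrix.add_mul, Matrix.mul_add, hX l, hY l]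
  zero_mem' l := by rw [Matrix.zero_mul, Matrix.mul_zero]
  smul_mem' c X hX l := by rw [Matrix.smul_mul, Matrix.mul_smul, hX l]

theorem mem_intertwiners {A : Fin p → Matrix n n K} {D : Fin p → Matrix ι ι K}
    {X : Matrix ι n K} : X ∈ intertwiners A D ↔ ∀ l, X * A l = D l * X := Iff.rfl

/-- The matrix of the linear system `X A_l = D_l X`. -/
def sylvester [DecidableEq n] [DecidableEq ι] (A : Fin p → Matrix n n K)
    (D : Fin p → Matrix ι ι K) : Matrix (Fin p × n × ι) (n × ι) K :=
  Matrix.of fun li j => ((A li.1)ᵀ ⊗ₖ (1 : Matrix ι ι K) - (1 : Matrix n n K) ⊗ₖ D li.1) li.2 j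

theorem sylvester_mulVec_vec [DecidableEq n] [DecidableEq ι] (A : Fin p → Matrix n n K)
    (D : Fin p → Matrix ι ι K) (X : Matrix ι n K) (l : Fin p) (i : n × ι) :
    (sylvester A D *ᵥ X.vec) (l, i) = (X * A l - D l * X).vec i := by
  have h : (sylvester A D *ᵥ X.vec) (l, i) =
      (((A l)ᵀ ⊗ₖ (1 : Matrix ι ι K) - (1 : Matrix n n K) ⊗ₖ D l) *ᵥ X.vec) i := rfl
  rw [h, sub_mulVec, kronecker_mulVec_vec, kronecker_mulVec_vec, vec_sub]
  simp

theorem finrank_intertwiners [DecidableEq n] [DecidableEq ι] (A : Fin p → Matrix n n K)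
    (D : Fin p → Matrix ι ι K) :
    finrank K (intertwiners A D) + (sylvester A D).rank = Fintype.card n * Fintype.card ι := by
  let v : Matrix ι n K ≃ₗ[K] (n × ι → K) :=
    LinearEquiv.ofBijective
      { toFun := vec
        map_add' := vec_add
        map_smul' := vec_smul } vec_bijective
  have h : (intertwiners A D).map (v : Matrix ι n K →ₗ[K] (n × ι → K)) =
      LinearMap.ker (sylvester A D).mulVecLin := by
    ext w
    obtain ⟨X, rfl⟩ := v.surjective w
    have : (∀ l, X * A l = D l * X) ↔ sylvester A D *ᵥ X.vec = 0 := by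
      constructor
      · intro hX
        ext ⟨l, i⟩
        rw [sylvester_mulVec_vec, hX l, sub_self]
        rfl
      · intro hX l
        rw [← sub_eq_zero, ← vec_eq_zero_iff]
        ext i
        rw [← sylvester_mulVec_vec, hX]
        rfl
    rw [LinearMap.mem_ker, mulVecLin_apply]
    refine Iff.trans ?_ this
    constructor
    · rintro ⟨X', hX', h⟩
      exact v.injective h ▸ hX'
    · exact fun hX => ⟨X, hX, rfl⟩
  have h1 : finrank K (intertwiners A D) = finrank K (LinearMap.ker (sylvester A D).mulVecLin) := by
    rw [← h, LinearEquiv.finrank_map_eq]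
  have h2 := LinearMap.finrank_range_add_finrank_ker (sylvester A D).mulVecLin
  rw [finrank_fintype_fun_eq_card, Fintype.card_prod] at h2
  rw [h1, Matrix.rank, ← h2, add_comm]

theorem finrank_intertwiners_map {k : Type*} [Field k] [Algebra k K]
    (A : Fin p → Matrix n n k) (D : Fin p → Matrix ι ι k) :
    finrank K (intertwiners (fun l => (A l).map (algebraMap k K))
      (fun l => (D l).map (algebraMap k K))) = finrank k (intertwiners A D) := by
  classical
  have h1 := finrank_intertwiners A D
  have h2 := finrank_intertwiners (fun l => (A l).map (algebraMap k K))
      (fun l => (D l).map (algebraMap k K))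
  have h3 : sylvester (fun l => (A l).map (algebraMap k K))
      (fun l => (D l).map (algebraMap k K)) = (sylvester A D).map (algebraMap k K) := by
    ext ⟨l, i⟩ j
    simp [sylvester, Matrix.one_apply, apply_ite (algebraMap k K)]
  rw [h3, rank_map_algebraMap] at h2
  omega

/-- Adding to `D` a block without common eigenvalues with `A` does not change the space of
intertwiners. -/
theorem finrank_intertwiners_fromBlocks [DecidableEq n] [DecidableEq κ]
    (A : Fin p → Matrix n n K)
    (D : Fin p → Matrix ι ι K) (t : K) (l₀ : Fin p)
    (ht : (A l₀ - Matrix.scalar n t).det ≠ 0) :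
    finrank K (intertwiners A fun l => fromBlocks (D l) 0 0 (Matrix.scalar κ t)) =
      finrank K (intertwiners A D) := by
  have hmem (X : Matrix ι n K) (X' : Matrix κ n K) :
      fromRows X X' ∈ intertwiners A (fun l => fromBlocks (D l) 0 0 (Matrix.scalar κ t)) ↔
        X ∈ intertwiners A D ∧ X' = 0 := by
    simp only [mem_intertwiners, fromRows_mul, fromBlocks_mul_fromRows, Matrix.zero_mul, add_zero,
      zero_add, fromRows_inj.eq_iff, forall_and]
    refine and_congr_right fun _ => ⟨fun h => ?_, ?_⟩
    · have h0 : X' * (A l₀ - Matrix.scalar n t) = 0 := by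
        rw [Matrix.mul_sub, h l₀, sub_eq_zero]
        ext i j
        simp [mul_comm]
      have hu : IsUnit (A l₀ - Matrix.scalar n t).det := isUnit_iff_ne_zero.2 ht
      rw [← mul_nonsing_inv_cancel_right _ X' hu, h0, Matrix.zero_mul]
    · rintro rfl
      simp
  let j : Matrix ι n K →ₗ[K] Matrix (ι ⊕ κ) n K :=
    { toFun := fun X => fromRows X 0
      map_add' := fun X Y => by ext (_ | _) _ <;> simp
      map_smul' := fun c X => by ext (_ | _) _ <;> simp }
  have hj : Function.Injective j := fun X Y h => (fromRows_inj h).1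
  rw [(Submodule.equivMapOfInjective j hj (intertwiners A D)).finrank_eq]
  refine congrArg (fun S : Submodule K _ => finrank K S) ?_
  ext Z
  constructor
  · intro hZ
    rw [← fromRows_toRows Z, hmem] at hZ
    refine ⟨_, hZ.1, ?_⟩
    conv_rhs => rw [← fromRows_toRows Z, hZ.2]
    rfl
  · rintro ⟨X, hX, rfl⟩
    exact (hmem X 0).2 ⟨hX, rfl⟩

theorem finrank_intertwiners_reindex (A : Fin p → Matrix n n K)
    (D : Fin p → Matrix ι ι K) (e : ι ≃ κ) :
    finrank K (intertwiners A fun l => reindex e e (D l)) = finrank K (intertwiners A D) := by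
  rw [← LinearEquiv.finrank_map_eq (reindexLinearEquiv K K e (Equiv.refl n)) (intertwiners A D)]
  refine congrArg (fun S : Submodule K _ => finrank K S) ?_
  ext Z
  obtain ⟨X, rfl⟩ := (reindexLinearEquiv K K e (Equiv.refl n)).surjective Z
  rw [Submodule.mem_map_equiv, LinearEquiv.symm_apply_apply, mem_intertwiners, mem_intertwiners]
  refine forall_congr' fun l => ?_
  have h1 : reindexLinearEquiv K K e (Equiv.refl n) X * A l =
      reindexLinearEquiv K K e (Equiv.refl n) (X * A l) := by
    ext; simp [mul_apply]
  have h2 : reindex e e (D l) * reindexLinearEquiv K K e (Equiv.refl n) X =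
      reindexLinearEquiv K K e (Equiv.refl n) (D l * X) := by
    ext
    simp only [coe_reindexLinearEquiv, reindex_apply, submatrix_apply, mul_apply]
    exact Equiv.sum_comp e.symm fun x => D l _ x * X x _
  rw [h1, h2, EmbeddingLike.apply_eq_iff_eq]

end Intertwiners

section Minors

variable {k : Type*} [Field k]

/-- Left multiplication by a constant matrix does not enlarge the span of the minors. -/
theorem det_submatrix_mul_mem_span {R : Type*} [CommRing R] [Algebra k R] {m m' n : Type*}
    [Fintype m] (P : Matrix m' m k) (M : Matrix m n R) {r : ℕ} (α : Fin r → m') (β : Fin r → n) :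
    ((P.map (algebraMap k R) * M).submatrix α β).det ∈
      Submodule.span k {f | ∃ γ : Fin r → m, Function.Injective γ ∧
        f = (M.submatrix γ β).det} := by
  have hrow : (P.map (algebraMap k R) * M).submatrix α β =
      fun i => ∑ j, algebraMap k R (P (α i) j) • fun x => M j (β x) := by
    ext i x
    simp [mul_apply, Finset.sum_apply, Algebra.smul_def]
  have := (detRowAlternating (R := R) (n := Fin r)).toMultilinearMap.map_sum
    (fun i j => algebraMap k R (P (α i) j) • fun x => M j (β x))
  rw [hrow]
  refine (congrArg (· ∈ _) this).mpr (Submodule.sum_mem _ fun γ _ => ?_)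
  rw [MultilinearMap.map_smul_univ, ← map_prod, algebraMap_smul]
  refine Submodule.smul_mem _ _ ?_
  by_cases hγ : Function.Injective γ
  · exact Submodule.subset_span ⟨γ, hγ, rfl⟩
  · obtain ⟨i, j, hij, hne⟩ := Function.not_injective_iff.1 hγ
    have h0 : (M.submatrix γ β).det = 0 :=
      det_zero_of_row_eq hne (by ext x; simp [hij])
    exact (congrArg (· ∈ _) h0).mpr (zero_mem _)

theorem det_submatrix_mul_mul_mem_span {R : Type*} [CommRing R] [Algebra k R] {m n : Type*}
    [Fintype m] [Fintype n] (P : Matrix m m k) (M : Matrix m n R) (Q : Matrix n n k) {r : ℕ}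
    (α : Fin r → m) (β : Fin r → n) :
    ((P.map (algebraMap k R) * M * Q.map (algebraMap k R)).submatrix α β).det ∈
      Submodule.span k {f | ∃ (γ : Fin r → m) (δ : Fin r → n), Function.Injective γ ∧
        Function.Injective δ ∧ f = (M.submatrix γ δ).det} := by
  rw [Matrix.mul_assoc]
  refine Submodule.span_le.2 ?_ (det_submatrix_mul_mem_span P _ α β)
  rintro _ ⟨γ, hγ, rfl⟩
  rw [← det_transpose, transpose_submatrix, transpose_mul, ← transpose_map]
  refine Submodule.span_mono ?_ (det_submatrix_mul_mem_span Qᵀ Mᵀ β γ)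
  rintro _ ⟨δ, hδ, rfl⟩
  exact ⟨γ, δ, hγ, hδ, by rw [← det_transpose, transpose_submatrix, transpose_transpose]⟩

variable {n p : ℕ}

theorem LMat_conj {R : Type*} [CommRing R] [Algebra k R] (A : Fin p → Matrix (Fin n) (Fin n) k)
    (Y : Fin p → Matrix (Fin n) (Fin n) R) (S T : Matrix (Fin n) (Fin n) k) (h : S * T = 1) :
    LMat (fun l => S * A l * T) Y =
      ((1 : Matrix (Fin p) (Fin p) k) ⊗ₖ (Tᵀ ⊗ₖ (1 : Matrix (Fin n) (Fin n) k))).map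
          (algebraMap k R) * LMat A Y *
        (Sᵀ ⊗ₖ (1 : Matrix (Fin n) (Fin n) k)).map (algebraMap k R) := by
  have h' : (T.map (algebraMap k R))ᵀ * (S.map (algebraMap k R))ᵀ = 1 := by
    rw [← transpose_mul, ← Matrix.map_mul, h]
    simp
  have hmap (Z : Matrix (Fin n) (Fin n) k) :
      (Z ⊗ₖ (1 : Matrix (Fin n) (Fin n) k)).map (algebraMap k R) =
        Z.map (algebraMap k R) ⊗ₖ (1 : Matrix (Fin n) (Fin n) R) := by
    ext i j
    simp [one_apply, apply_ite (algebraMap k R)]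
  have hblock (l : Fin p) :
      ((S * A l * T).map (algebraMap k R))ᵀ ⊗ₖ (1 : Matrix (Fin n) (Fin n) R) -
          (1 : Matrix (Fin n) (Fin n) R) ⊗ₖ Y l =
        (Tᵀ ⊗ₖ (1 : Matrix (Fin n) (Fin n) k)).map (algebraMap k R) *
          (((A l).map (algebraMap k R))ᵀ ⊗ₖ (1 : Matrix (Fin n) (Fin n) R) -
            (1 : Matrix (Fin n) (Fin n) R) ⊗ₖ Y l) *
          (Sᵀ ⊗ₖ (1 : Matrix (Fin n) (Fin n) k)).map (algebraMap k R) := by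
    rw [hmap, hmap, Matrix.mul_sub, Matrix.sub_mul, ← mul_kronecker_mul, ← mul_kronecker_mul,
      ← mul_kronecker_mul, ← mul_kronecker_mul, transpose_map, transpose_map]
    simp only [Matrix.mul_one, Matrix.one_mul, h', Matrix.map_mul, transpose_mul, Matrix.mul_assoc]
  ext ⟨l, i⟩ j
  refine (congr($(hblock l) i j)).trans ?_
  simp only [mul_apply, Fintype.sum_prod_type, map_apply, kroneckerMap_apply, one_apply, LMat,
    of_apply, ite_mul, one_mul, zero_mul, apply_ite (algebraMap k R), map_zero,
    Finset.sum_ite_irrel, Finset.sum_const_zero, Finset.sum_ite_eq, Finset.mem_univ, if_true]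

theorem minorSpan_conj_le (A : Fin p → Matrix (Fin n) (Fin n) k)
    (S T : Matrix (Fin n) (Fin n) k) (h : S * T = 1) (r : ℕ) :
    minorSpan (fun l => S * A l * T) r ≤ minorSpan A r := by
  refine Submodule.span_le.2 ?_
  rintro _ ⟨α, β, -, -, rfl⟩
  rw [LMat_conj A _ S T h]
  exact det_submatrix_mul_mul_mem_span _ _ _ α β

theorem LMat_map_aeval {K : Type*} [Field K] [Algebra k K]
    (A : Fin p → Matrix (Fin n) (Fin n) k) (Y : Fin p → Matrix (Fin n) (Fin n) K) :
    (LMat A (genericY k n p)).map (MvPolynomial.aeval fun s => Y s.2.2 s.1 s.2.1) =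
      sylvester (fun l => (A l).map (algebraMap k K)) Y := by
  ext ⟨l, i⟩ j
  simp [LMat, sylvester, genericY, one_apply,
    apply_ite (MvPolynomial.aeval fun s : Fin n × Fin n × Fin p => Y s.2.2 s.1 s.2.1)]

theorem rank_sylvester_le_of_minorSpan_le {K : Type*} [Field K] [Algebra k K]
    {A B : Fin p → Matrix (Fin n) (Fin n) k}
    (h : ∀ r : ℕ, 1 ≤ r → r ≤ n ^ 2 → minorSpan A r ≤ minorSpan B r)
    (Y : Fin p → Matrix (Fin n) (Fin n) K) :
    (sylvester (fun l => (A l).map (algebraMap k K)) Y).rank ≤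
      (sylvester (fun l => (B l).map (algebraMap k K)) Y).rank := by
  set φ : MvPolynomial (Fin n × Fin n × Fin p) k →ₐ[k] K :=
    MvPolynomial.aeval fun s => Y s.2.2 s.1 s.2.1
  have key (D : Fin p → Matrix (Fin n) (Fin n) k) {r : ℕ} (α : Fin r → Fin p × Fin n × Fin n)
      (β : Fin r → Fin n × Fin n) :
      φ ((LMat D (genericY k n p)).submatrix α β).det =
        ((sylvester (fun l => (D l).map (algebraMap k K)) Y).submatrix α β).det := by
    rw [← LMat_map_aeval, AlgHom.map_det]
    rfl
  obtain ⟨r, hrank, α, β, hα, hβ, hdet⟩ :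
      ∃ r, (sylvester (fun l => (A l).map (algebraMap k K)) Y).rank = r ∧
        ∃ (α : Fin r → Fin p × Fin n × Fin n) (β : Fin r → Fin n × Fin n),
          Function.Injective α ∧ Function.Injective β ∧
            ((sylvester (fun l => (A l).map (algebraMap k K)) Y).submatrix α β).det ≠ 0 :=
    ⟨_, rfl, exists_det_submatrix_ne_zero (sylvester (fun l => (A l).map (algebraMap k K)) Y)⟩
  rw [hrank]
  rcases Nat.eq_zero_or_pos r with h0 | hpos
  · rw [h0]
    exact Nat.zero_le _
  have hr : r ≤ n ^ 2 := by
    simpa [sq, hrank] using rank_le_card_width (sylvester (fun l => (A l).map (algebraMap k K)) Y)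
  rw [← key] at hdet
  by_contra hlt
  refine hdet (?_ : _ ∈ LinearMap.ker φ.toLinearMap)
  refine Submodule.span_le.2 ?_ (h r hpos hr (Submodule.subset_span ⟨α, β, hα, hβ, rfl⟩))
  rintro _ ⟨γ, δ, -, -, rfl⟩
  by_contra hne
  refine hlt (le_rank_of_det_submatrix_ne_zero _ γ δ ?_)
  rw [← key]
  exact hne

/-- Equal spans of minors give equal dimensions of the spaces of intertwiners into tuples of
size at most `n`. -/
theorem finrank_intertwiners_eq {A B : Fin p → Matrix (Fin n) (Fin n) k} (l₀ : Fin p)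
    (h : ∀ r : ℕ, 1 ≤ r → r ≤ n ^ 2 → minorSpan A r = minorSpan B r)
    {m : ℕ} (hm : m ≤ n) (D : Fin p → Matrix (Fin m) (Fin m) k) :
    Module.finrank k (intertwiners A D) = Module.finrank k (intertwiners B D) := by
  let K := FractionRing (Polynomial k)
  let t : K := algebraMap (Polynomial k) K Polynomial.X
  let e : Fin m ⊕ Fin (n - m) ≃ Fin n := finSumFinEquiv.trans (finCongr (by omega))
  let Y : Fin p → Matrix (Fin n) (Fin n) K := fun l =>
    reindex e e (fromBlocks ((D l).map (algebraMap k K)) 0 0 (Matrix.scalar _ t))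
  have key (C : Fin p → Matrix (Fin n) (Fin n) k) :
      Module.finrank k (intertwiners C D) =
        Module.finrank K (intertwiners (fun l => (C l).map (algebraMap k K)) Y) := by
    rw [finrank_intertwiners_reindex, finrank_intertwiners_fromBlocks _ _ t l₀,
      finrank_intertwiners_map]
    have : (C l₀).map (algebraMap k K) - Matrix.scalar (Fin n) t =
        -((charmatrix (C l₀)).map (algebraMap (Polynomial k) K)) := by
      ext i j
      rw [IsScalarTower.algebraMap_eq k (Polynomial k) K]
      by_cases hij : i = j
      · subst hij
        simp [t]
      · simp [hij]
        exact (neg_neg _).symm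
    rw [this, det_neg]
    refine mul_ne_zero (pow_ne_zero _ (neg_ne_zero.2 one_ne_zero)) ?_
    have hdet := (algebraMap (Polynomial k) K).map_det (charmatrix (C l₀))
    rw [RingHom.mapMatrix_apply] at hdet
    rw [← hdet]
    exact fun h0 => (charpoly_monic (C l₀)).ne_zero
      ((FaithfulSMul.algebraMap_injective (Polynomial k) K) (h0.trans (map_zero _).symm))
  have hrank := le_antisymm
    (rank_sylvester_le_of_minorSpan_le (fun r h1 h2 => (h r h1 h2).le) Y)
    (rank_sylvester_le_of_minorSpan_le (fun r h1 h2 => (h r h1 h2).ge) Y)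
  have hA := finrank_intertwiners (fun l => (A l).map (algebraMap k K)) Y
  have hB := finrank_intertwiners (fun l => (B l).map (algebraMap k K)) Y
  rw [key A, key B]
  omega

end Minors

section TupleModule

universe u

open Module

variable {k : Type u} [Field k] {n p : ℕ}

/-- The module over the free algebra on `p` generators given by a `p`-tuple of matrices. -/
def TupleModule (_ : Fin p → Matrix (Fin n) (Fin n) k) : Type u := Fin n → k

variable (A : Fin p → Matrix (Fin n) (Fin n) k)

instance : AddCommGroup (TupleModule A) := inferInstanceAs (AddCommGroup (Fin n → k))

instance : Module k (TupleModule A) := inferInstanceAs (Module k (Fin n → k))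

instance : Module.Finite k (TupleModule A) := inferInstanceAs (Module.Finite k (Fin n → k))

/-- The action of the free algebra on `TupleModule A`. -/
def tupleAction : FreeAlgebra k (Fin p) →ₐ[k] Module.End k (TupleModule A) :=
  FreeAlgebra.lift k fun l => toLin' (A l)

instance : Module (FreeAlgebra k (Fin p)) (TupleModule A) :=
  Module.compHom (TupleModule A) (tupleAction A).toRingHom

theorem smul_tupleModule (x : FreeAlgebra k (Fin p)) (v : TupleModule A) :
    x • v = tupleAction A x v := rfl

instance : IsScalarTower k (FreeAlgebra k (Fin p)) (TupleModule A) where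
  smul_assoc c x v := by
    rw [smul_tupleModule, smul_tupleModule, map_smul]
    rfl

theorem ι_smul_tupleModule (l : Fin p) (v : TupleModule A) :
    FreeAlgebra.ι k l • v = A l *ᵥ v := by
  exact DFunLike.congr_fun (FreeAlgebra.lift_ι_apply (A := Module.End k (TupleModule A))
    (fun l => toLin' (A l)) l) v

/-- A `k`-linear map commuting with the generators is linear over the free algebra. -/
def homOfCommutes {M C : Type*} [AddCommGroup M] [AddCommGroup C] [Module k M] [Module k C]
    [Module (FreeAlgebra k (Fin p)) M] [Module (FreeAlgebra k (Fin p)) C]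
    [IsScalarTower k (FreeAlgebra k (Fin p)) M] [IsScalarTower k (FreeAlgebra k (Fin p)) C]
    (f : M →ₗ[k] C) (hf : ∀ (l : Fin p) v, f (FreeAlgebra.ι k l • v) = FreeAlgebra.ι k l • f v) :
    M →ₗ[FreeAlgebra k (Fin p)] C where
  toFun := f
  map_add' := f.map_add
  map_smul' x := by
    induction x using FreeAlgebra.induction with
    | grade0 c => intro v; simp [algebraMap_smul]
    | grade1 l => exact hf l
    | mul x y hx hy => intro v; rw [mul_smul, hx, hy]; exact (mul_smul x y (f v)).symm
    | add x y hx hy => intro v; rw [add_smul, map_add, hx, hy]; exact (add_smul x y (f v)).symm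

theorem finrank_hom_tupleModule {m : ℕ} {C : Type*} [AddCommGroup C] [Module k C]
    [Module (FreeAlgebra k (Fin p)) C] [IsScalarTower k (FreeAlgebra k (Fin p)) C]
    (b : Basis (Fin m) k C) :
    finrank k (TupleModule A →ₗ[FreeAlgebra k (Fin p)] C) =
      finrank k (intertwiners A fun l =>
        LinearMap.toMatrix b b (Algebra.lsmul k k C (FreeAlgebra.ι k l))) := by
  let τ : ((Fin n → k) →ₗ[k] C) ≃ₗ[k] Matrix (Fin m) (Fin n) k :=
    LinearMap.toMatrix (Pi.basisFun k (Fin n)) b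
  let j : (TupleModule A →ₗ[FreeAlgebra k (Fin p)] C) →ₗ[k] Matrix (Fin m) (Fin n) k :=
    τ.toLinearMap ∘ₗ homRestrict k (FreeAlgebra k (Fin p)) (TupleModule A) C
  have hj : Function.Injective j := τ.injective.comp homRestrict_injective
  rw [← LinearMap.finrank_range_of_inj hj]
  refine congrArg (fun S : Submodule k _ => finrank k S) ?_
  have key (f : (Fin n → k) →ₗ[k] C) :
      τ f ∈ (intertwiners A fun l =>
        LinearMap.toMatrix b b (Algebra.lsmul k k C (FreeAlgebra.ι k l))) ↔
      ∀ l (v : TupleModule A), f (A l *ᵥ v) = FreeAlgebra.ι k l • f v := by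
    rw [mem_intertwiners]
    refine forall_congr' fun l => ?_
    have h1 : τ f * A l = τ (f ∘ₗ toLin' (A l)) := by
      have h0 : LinearMap.toMatrix (Pi.basisFun k (Fin n)) (Pi.basisFun k (Fin n))
          (toLin' (A l)) = A l := by
        rw [LinearMap.toMatrix_eq_toMatrix', LinearMap.toMatrix'_toLin']
      have := LinearMap.toMatrix_comp (Pi.basisFun k (Fin n)) (Pi.basisFun k (Fin n)) b f
        (toLin' (A l))
      rw [h0] at this
      exact this.symm
    have h2 : LinearMap.toMatrix b b (Algebra.lsmul k k C (FreeAlgebra.ι k l)) * τ f =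
        τ (Algebra.lsmul k k C (FreeAlgebra.ι k l) ∘ₗ f) :=
      (LinearMap.toMatrix_comp (Pi.basisFun k (Fin n)) b b
        (Algebra.lsmul k k C (FreeAlgebra.ι k l)) f).symm
    rw [h1, h2, EmbeddingLike.apply_eq_iff_eq, LinearMap.ext_iff]
    rfl
  ext X
  obtain ⟨f, rfl⟩ := τ.surjective X
  rw [key]
  constructor
  · rintro ⟨g, hg⟩ l v
    have : (g.restrictScalars k : (Fin n → k) →ₗ[k] C) = f := τ.injective hg
    rw [← this, ← ι_smul_tupleModule]
    exact g.map_smul _ v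
  · intro hf
    let f' : TupleModule A →ₗ[k] C := f
    have hf' (l : Fin p) (v : TupleModule A) :
        f' (FreeAlgebra.ι k l • v) = FreeAlgebra.ι k l • f' v := by
      rw [ι_smul_tupleModule]
      exact hf l v
    exact ⟨homOfCommutes f' hf', rfl⟩

theorem exists_conj_of_linearEquiv {A B : Fin p → Matrix (Fin n) (Fin n) k}
    (e : TupleModule A ≃ₗ[FreeAlgebra k (Fin p)] TupleModule B) :
    ∃ S : GL (Fin n) k, ∀ i, B i = S.val * A i * S⁻¹.val := by
  let f : (Fin n → k) →ₗ[k] (Fin n → k) := e.toLinearMap.restrictScalars k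
  let g : (Fin n → k) →ₗ[k] (Fin n → k) := e.symm.toLinearMap.restrictScalars k
  have hfg : f ∘ₗ g = LinearMap.id := LinearMap.ext fun x => e.apply_symm_apply x
  have hgf : g ∘ₗ f = LinearMap.id := LinearMap.ext fun x => e.symm_apply_apply x
  let S : GL (Fin n) k := ⟨LinearMap.toMatrix' f, LinearMap.toMatrix' g,
    by rw [← LinearMap.toMatrix'_comp, hfg, LinearMap.toMatrix'_id],
    by rw [← LinearMap.toMatrix'_comp, hgf, LinearMap.toMatrix'_id]⟩
  refine ⟨S, fun i => ?_⟩
  have h : f ∘ₗ toLin' (A i) = toLin' (B i) ∘ₗ f := LinearMap.ext fun v =>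
    (congrArg e (ι_smul_tupleModule A i v)).symm.trans
      ((e.map_smul (FreeAlgebra.ι k i) v).trans (ι_smul_tupleModule B i (e v)))
  have h' := congrArg LinearMap.toMatrix' h
  rw [LinearMap.toMatrix'_comp, LinearMap.toMatrix'_comp, LinearMap.toMatrix'_toLin',
    LinearMap.toMatrix'_toLin'] at h'
  have hS : S.val * A i = B i * S.val := h'
  rw [hS, Matrix.mul_assoc, ← Units.val_mul, mul_inv_cancel, Units.val_one, Matrix.mul_one]

end TupleModule

end SimultaneousSimilarity

/-- Tuples `A` and `B` of `n×n` matrices are simultaneously similar iff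
for every `r ∈ [n²]` the `k`-span of the `r×r` minors of `L(A, Y)` equals the `k`-span
of the `r×r` minors of `L(B, Y)`, `Y` the generic tuple. -/
theorem stmt9 {k : Type*} [Field k] {n p : ℕ}
    (A B : Fin p → Matrix (Fin n) (Fin n) k) :
    (∃ S : GL (Fin n) k, ∀ i, B i = S.val * A i * S⁻¹.val) ↔
      ∀ r : ℕ, 1 ≤ r → r ≤ n ^ 2 → minorSpan A r = minorSpan B r := by
  constructor
  · rintro ⟨S, hS⟩ r - -
    have hB : B = fun l => S.val * A l * S⁻¹.val := funext hS
    have hA : A = fun l => S⁻¹.val * B l * S.val := by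
      ext1 l
      rw [hS l, Matrix.mul_assoc, Matrix.mul_assoc, Matrix.mul_assoc, Units.inv_mul,
        Matrix.mul_one, ← Matrix.mul_assoc, Units.inv_mul, Matrix.one_mul]
    apply le_antisymm
    · conv_lhs => rw [hA]
      exact SimultaneousSimilarity.minorSpan_conj_le B _ _ S.inv_mul r
    · conv_lhs => rw [hB]
      exact SimultaneousSimilarity.minorSpan_conj_le A _ _ S.mul_inv r
  · intro h
    rcases isEmpty_or_nonempty (Fin p) with hp | ⟨⟨l₀⟩⟩
    · exact ⟨1, fun i => hp.elim i⟩
    have hdim (D : Fin p → Matrix (Fin n) (Fin n) k) :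
        Module.finrank k (SimultaneousSimilarity.TupleModule D) = n :=
      Module.finrank_fin_fun k
    obtain ⟨e⟩ := SimultaneousSimilarity.nonempty_linearEquiv_of_finrank_hom_eq k
      (FreeAlgebra k (Fin p)) n n (SimultaneousSimilarity.TupleModule A)
      (SimultaneousSimilarity.TupleModule B) (hdim A).le (hdim B).le (hdim B)
      fun C _ _ _ _ _ hC => by
        have b := Module.finBasis k C
        rw [SimultaneousSimilarity.finrank_hom_tupleModule A b,
          SimultaneousSimilarity.finrank_hom_tupleModule B b]
        exact SimultaneousSimilarity.finrank_intertwiners_eq l₀ h hC _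
    exact SimultaneousSimilarity.exists_conj_of_linearEquiv e
end
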